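/- arXiv:2305.11062 — 5 statements merged into one kernel-verified Lean document; each statement's English description precedes it below -/
import Mathlib

section
/- Let G be an abelian group with no elements of order 2, and let A, B be finite multisets of G such that μ_A − μ_B ∈ V(G). Then there is a finite sequence of multisets A = E₀, E₁, …, E_m = B such that each E_{i+1} is obtained from E_i by applying a single move: either replacing one element g ∈ E_i by −g, or, for some odd n ≥ 3, units α, β ∈ (ℤ/nℤ)^×, and injective group homomorphism ι : ℤ/nℤ → G with ι(αU_n) ⊆ E_i, replacing the sub-multiset ι(αU_n) by ι(βU_n). -/
open scoped BigOperators

/-- `μ : G → ℤ` belongs to `V(G)`. -/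
def memV {G : Type*} [AddCommGroup G] (μ : G → ℤ) : Prop :=
  (Function.support μ).Finite ∧
  (∀ g : G, μ g + μ (-g) = μ (g + g) + μ (-(g + g))) ∧
  (∀ H : AddSubgroup G, ∑ᶠ g ∈ (H : Set G), μ g = 0)

/-- The minimal `k ≥ 1` such that `2^k ≡ ±1 (mod n)`. -/
noncomputable def Upow (n : ℕ) : ℕ :=
  sInf {k : ℕ | 1 ≤ k ∧ ((2 : ZMod n) ^ k = 1 ∨ (2 : ZMod n) ^ k = -1)}

/-- The set `U_n = {1, 2, 4, …, 2^{k-1}} ⊆ ℤ/nℤ`. -/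
noncomputable def Uset (n : ℕ) : Finset (ZMod n) :=
  (Finset.range (Upow n)).image (fun i => (2 : ZMod n) ^ i)

/-- The multiset `ι(α U_n)` inside `G`. -/
noncomputable def UMultiset {G : Type*} [AddCommGroup G] (n : ℕ) (α : (ZMod n)ˣ)
    (ι : ZMod n →+ G) : Multiset G :=
  (Uset n).val.map (fun u => ι ((α : ZMod n) * u))

/-- The two types of moves: flipping the sign of one element, or replacing `ι(α Uₙ)` by
`ι(β Uₙ)`. -/
noncomputable def IsMove {G : Type*} [AddCommGroup G] [DecidableEq G]
    (E E' : Multiset G) : Prop :=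
  (∃ g ∈ E, E' = (-g) ::ₘ E.erase g) ∨
  (∃ n : ℕ, Odd n ∧ 3 ≤ n ∧ ∃ (α β : (ZMod n)ˣ) (ι : ZMod n →+ G),
    Function.Injective ⇑ι ∧ UMultiset n α ι ≤ E ∧
    E' = (E - UMultiset n α ι) + UMultiset n β ι)

section Symmetrization

variable {G : Type*} [AddCommGroup G]

/-- The multiset consisting of the elements of `A` and their negatives. -/
def symmetrize (A : Multiset G) : Multiset G := A + A.map (fun x => -x)

@[simp] lemma symmetrize_zero : symmetrize (0 : Multiset G) = 0 := rfl

lemma symmetrize_add (A B : Multiset G) :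
    symmetrize (A + B) = symmetrize A + symmetrize B := by
  simp only [symmetrize, Multiset.map_add]; abel

lemma symmetrize_cons (a : G) (A : Multiset G) :
    symmetrize (a ::ₘ A) = {a, -a} + symmetrize A := by
  rw [← Multiset.singleton_add, symmetrize_add]; rfl

lemma symmetrize_neg_cons (a : G) (A : Multiset G) :
    symmetrize (-a ::ₘ A) = symmetrize (a ::ₘ A) := by
  rw [symmetrize_cons, symmetrize_cons, neg_neg, Multiset.pair_comm]

lemma mem_symmetrize {A : Multiset G} {x : G} : x ∈ symmetrize A ↔ x ∈ A ∨ -x ∈ A := by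
  simp [symmetrize, neg_eq_iff_eq_neg]

lemma card_symmetrize (A : Multiset G) : (symmetrize A).card = A.card + A.card := by
  simp [symmetrize]

lemma countP_symmetrize (H : AddSubgroup G) [DecidablePred (· ∈ H)] (A : Multiset G) :
    (symmetrize A).countP (· ∈ H) = A.countP (· ∈ H) + A.countP (· ∈ H) := by
  rw [symmetrize, Multiset.countP_add, Multiset.countP_map]
  simp only [neg_mem_iff, Multiset.countP_eq_card_filter]

lemma exists_cons_of_mem_symmetrize {A : Multiset G} {x : G} (hx : x ∈ symmetrize A) :
    ∃ A', symmetrize A = symmetrize (x ::ₘ A') ∧ (A = x ::ₘ A' ∨ A = -x ::ₘ A') := by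
  rcases mem_symmetrize.1 hx with h | h
  · obtain ⟨A', rfl⟩ := Multiset.exists_cons_of_mem h
    exact ⟨A', rfl, .inl rfl⟩
  · obtain ⟨A', rfl⟩ := Multiset.exists_cons_of_mem h
    exact ⟨A', symmetrize_neg_cons _ _, .inr rfl⟩

lemma exists_symmetrize_add_eq (U A : Multiset G) (h : symmetrize U ≤ symmetrize A) :
    ∃ C, symmetrize (U + C) = symmetrize A := by
  induction U using Multiset.induction generalizing A with
  | empty => exact ⟨A, by simp⟩
  | cons u U ih =>
    have hu : u ∈ symmetrize A :=
      Multiset.mem_of_le h (mem_symmetrize.2 (.inl (Multiset.mem_cons_self _ _)))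
    obtain ⟨A', hA', -⟩ := exists_cons_of_mem_symmetrize hu
    rw [hA', symmetrize_cons, symmetrize_cons, add_le_add_iff_left] at h
    obtain ⟨C, hC⟩ := ih A' h
    exact ⟨C, by rw [hA', Multiset.cons_add, symmetrize_cons, hC, symmetrize_cons]⟩

variable [DecidableEq G]

lemma count_symmetrize (A : Multiset G) (x : G) :
    (symmetrize A).count x = A.count x + A.count (-x) := by
  have h := Multiset.count_map_eq_count' (fun y : G => -y) A neg_injective (-x)
  simp only [neg_neg] at h
  rw [symmetrize, Multiset.count_add, h]

lemma IsMove.add_left {E E' : Multiset G} (h : IsMove E E') (F : Multiset G) :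
    IsMove (F + E) (F + E') := by
  rcases h with ⟨g, hg, rfl⟩ | ⟨n, hn, hn3, α, β, ι, hι, hU, rfl⟩
  · refine .inl ⟨g, Multiset.mem_add.2 (.inr hg), ?_⟩
    rw [Multiset.erase_add_right_pos _ hg, Multiset.add_cons]
  · refine .inr ⟨n, hn, hn3, α, β, ι, hι, hU.trans (Multiset.le_add_left _ _), ?_⟩
    rw [add_tsub_assoc_of_le hU, add_assoc]

lemma isMove_neg_cons (a : G) (A : Multiset G) : IsMove (a ::ₘ A) (-a ::ₘ A) :=
  .inl ⟨a, Multiset.mem_cons_self _ _, by rw [Multiset.erase_cons_head]⟩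

lemma reflTransGen_isMove_of_symmetrize_eq (A B : Multiset G)
    (h : symmetrize A = symmetrize B) : Relation.ReflTransGen IsMove A B := by
  induction A using Multiset.induction generalizing B with
  | empty =>
    have hB : B.card = 0 := by
      have := congrArg Multiset.card h
      rw [card_symmetrize, card_symmetrize, Multiset.card_zero] at this
      omega
    rw [Multiset.card_eq_zero.1 hB]
  | cons a A ih =>
    have ha : a ∈ symmetrize B := h ▸ mem_symmetrize.2 (.inl (Multiset.mem_cons_self _ _))
    obtain ⟨B', hB', hB⟩ := exists_cons_of_mem_symmetrize ha
    rw [hB', symmetrize_cons, symmetrize_cons, add_right_inj] at h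
    have key : Relation.ReflTransGen IsMove (a ::ₘ A) (a ::ₘ B') := by
      simp only [← Multiset.singleton_add]
      exact (ih B' h).lift _ fun _ _ hm => hm.add_left {a}
    rcases hB with rfl | rfl
    · exact key
    · exact key.tail (isMove_neg_cons a B')

end Symmetrization

section PowersOfTwo

lemma upow_spec {n : ℕ} (hn : Odd n) :
    1 ≤ Upow n ∧ ((2 : ZMod n) ^ Upow n = 1 ∨ (2 : ZMod n) ^ Upow n = -1) := by
  refine Nat.sInf_mem (s := {k : ℕ | 1 ≤ k ∧ ((2 : ZMod n) ^ k = 1 ∨ (2 : ZMod n) ^ k = -1)})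
    ⟨n.totient, Nat.totient_pos.2 hn.pos, .inl ?_⟩
  have := ZMod.pow_totient (ZMod.unitOfCoprime 2 (Nat.coprime_two_left.2 hn))
  simpa only [Units.ext_iff, Units.val_pow_eq_pow_val, ZMod.coe_unitOfCoprime, Nat.cast_ofNat,
    Units.val_one] using this

lemma two_pow_ne_neg_one {n m : ℕ} (hn : 3 ≤ n) (hm : m < Upow n) :
    (2 : ZMod n) ^ m ≠ -1 := by
  intro h
  rcases Nat.eq_zero_or_pos m with rfl | hpos
  · have h2 : ((2 : ℕ) : ZMod n) = 0 := by
      push_cast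
      linear_combination h
    have := Nat.le_of_dvd two_pos ((ZMod.natCast_eq_zero_iff 2 n).1 h2)
    omega
  · exact Nat.notMem_of_lt_sInf hm ⟨hpos, .inr h⟩

lemma isUnit_two_zmod {n : ℕ} (hn : Odd n) : IsUnit (2 : ZMod n) := by
  simpa using (ZMod.isUnit_iff_coprime 2 n).2 (Nat.coprime_two_left.2 hn)

lemma two_pow_ne_neg_two_pow {n i j : ℕ} (hn : Odd n) (hn3 : 3 ≤ n) (hi : i < Upow n)
    (hj : j < Upow n) : (2 : ZMod n) ^ i ≠ -2 ^ j := by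
  wlog hij : i ≤ j generalizing i j
  · intro h
    exact this hj hi (le_of_not_ge hij) (by rw [h, neg_neg])
  intro h
  obtain ⟨m, rfl⟩ := Nat.exists_eq_add_of_le hij
  refine two_pow_ne_neg_one hn3 (lt_of_le_of_lt (Nat.le_add_left m i) hj) ?_
  refine ((isUnit_two_zmod hn).pow i).mul_left_cancel ?_
  rw [← pow_add, h]; simp

end PowersOfTwo

section UMultiset

variable {G : Type*} [AddCommGroup G] {n : ℕ} {α : (ZMod n)ˣ} {ι : ZMod n →+ G}

lemma mem_UMultiset {x : G} :
    x ∈ UMultiset n α ι ↔ ∃ i < Upow n, ι ((α : ZMod n) * 2 ^ i) = x := by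
  simp [UMultiset, Uset]

lemma card_UMultiset : (UMultiset n α ι).card = (Uset n).card := by
  simp [UMultiset]

lemma map_unit_mem_iff (hn : n ≠ 0) (H : AddSubgroup G) (u : (ZMod n)ˣ) :
    ι (u : ZMod n) ∈ H ↔ ∀ z, ι z ∈ H := by
  refine ⟨fun h z => ?_, fun h => h _⟩
  have : NeZero n := ⟨hn⟩
  have hz : z = ((u⁻¹ : (ZMod n)ˣ) * z : ZMod n).val • (u : ZMod n) := by
    rw [nsmul_eq_mul, ZMod.natCast_zmod_val, mul_comm, ← mul_assoc, Units.mul_inv, one_mul]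
  rw [hz, map_nsmul]
  exact H.nsmul_mem h _

lemma mem_of_mem_UMultiset (hn : Odd n) (H : AddSubgroup G) {x : G}
    (hx : x ∈ UMultiset n α ι) : x ∈ H ↔ ∀ z, ι z ∈ H := by
  obtain ⟨i, -, rfl⟩ := mem_UMultiset.1 hx
  have h := map_unit_mem_iff (ι := ι) hn.pos.ne' H (α * (isUnit_two_zmod hn).unit ^ i)
  simpa using h

lemma countP_UMultiset (hn : Odd n) (H : AddSubgroup G) [DecidablePred (· ∈ H)]
    (α β : (ZMod n)ˣ) :
    (UMultiset n α ι).countP (· ∈ H) = (UMultiset n β ι).countP (· ∈ H) := by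
  by_cases h : ∀ z, ι z ∈ H
  · rw [Multiset.countP_eq_card.2 fun x hx => (mem_of_mem_UMultiset hn H hx).2 h,
      Multiset.countP_eq_card.2 fun x hx => (mem_of_mem_UMultiset hn H hx).2 h,
      card_UMultiset, card_UMultiset]
  · rw [Multiset.countP_eq_zero.2 fun x hx hx' => h ((mem_of_mem_UMultiset hn H hx).1 hx'),
      Multiset.countP_eq_zero.2 fun x hx hx' => h ((mem_of_mem_UMultiset hn H hx).1 hx')]

lemma nodup_symmetrize_UMultiset (hn : Odd n) (hn3 : 3 ≤ n) (hι : Function.Injective ι) :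
    (symmetrize (UMultiset n α ι)).Nodup := by
  have hU : (UMultiset n α ι).Nodup :=
    (Uset n).nodup.map (hι.comp α.isUnit.mul_right_injective)
  refine Multiset.nodup_add.2 ⟨hU, hU.map neg_injective, ?_⟩
  refine Multiset.disjoint_left.2 fun {x} hx hx' => ?_
  obtain ⟨y, hy, hyx⟩ := Multiset.mem_map.1 hx'
  obtain ⟨i, hi, rfl⟩ := mem_UMultiset.1 hx
  obtain ⟨j, hj, rfl⟩ := mem_UMultiset.1 hy
  rw [← map_neg, ← mul_neg] at hyx
  exact two_pow_ne_neg_two_pow hn hn3 hi hj (α.isUnit.mul_left_cancel (hι hyx)).symm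

lemma double_mem_symmetrize_UMultiset (hn : Odd n) {x : G}
    (hx : x ∈ symmetrize (UMultiset n α ι)) : x + x ∈ symmetrize (UMultiset n α ι) := by
  have key : ∀ y ∈ UMultiset n α ι, y + y ∈ symmetrize (UMultiset n α ι) := by
    intro y hy
    obtain ⟨i, hi, rfl⟩ := mem_UMultiset.1 hy
    rw [← map_add, ← mul_add, ← two_mul, ← pow_succ', mem_symmetrize]
    obtain ⟨hpos, hk⟩ := upow_spec hn
    rcases (Nat.succ_le_of_lt hi).lt_or_eq with hlt | heq
    · exact .inl (mem_UMultiset.2 ⟨i + 1, hlt, rfl⟩)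
    · rw [show i + 1 = Upow n from heq]
      rcases hk with hk | hk
      · exact .inl (mem_UMultiset.2 ⟨0, hpos, by rw [hk, pow_zero]⟩)
      · exact .inr (mem_UMultiset.2 ⟨0, hpos, by rw [hk, pow_zero, mul_neg, map_neg, neg_neg]⟩)
  rcases mem_symmetrize.1 hx with h | h
  · exact key x h
  · have := key _ h
    rw [mem_symmetrize] at this ⊢
    rw [← neg_add, neg_neg] at this
    exact this.symm

lemma count_double_symmetrize_UMultiset [DecidableEq G] (h2 : ∀ g : G, g + g = 0 → g = 0)
    (hn : Odd n) (hn3 : 3 ≤ n) (hι : Function.Injective ι) (x : G) :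
    (symmetrize (UMultiset n α ι)).count (x + x) = (symmetrize (UMultiset n α ι)).count x := by
  have hinj : Function.Injective (fun y : G => y + y) := fun y z hyz => by
    have hyz : y + y = z + z := hyz
    exact sub_eq_zero.1 (h2 _ (by rw [sub_add_sub_comm, hyz, sub_self]))
  have hnd := nodup_symmetrize_UMultiset (α := α) hn hn3 hι
  have hmap : (symmetrize (UMultiset n α ι)).map (fun y => y + y) =
      symmetrize (UMultiset n α ι) := by
    refine Multiset.eq_of_le_of_card_le
      ((Multiset.le_iff_subset (hnd.map hinj)).2 fun y hy => ?_) (by simp)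
    obtain ⟨z, hz, rfl⟩ := Multiset.mem_map.1 hy
    exact double_mem_symmetrize_UMultiset hn hz
  have := Multiset.count_map_eq_count' (fun y : G => y + y) (symmetrize (UMultiset n α ι)) hinj x
  simpa only [hmap] using this

lemma symmetrize_UMultiset_le (hn : Odd n) (hn3 : 3 ≤ n)
    (hι : Function.Injective ι) {D : Multiset G} (hneg : ∀ x ∈ D, -x ∈ D)
    (hdouble : ∀ x ∈ D, x + x ∈ D) (hα : ι α ∈ D) : symmetrize (UMultiset n α ι) ≤ D := by
  have hpow : ∀ i : ℕ, ι ((α : ZMod n) * 2 ^ i) ∈ D := by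
    intro i
    induction i with
    | zero => simpa using hα
    | succ i ih =>
      rw [pow_succ', two_mul, mul_add, map_add]
      exact hdouble _ ih
  refine (Multiset.le_iff_subset (nodup_symmetrize_UMultiset hn hn3 hι)).2 fun x hx => ?_
  rcases mem_symmetrize.1 hx with h | h
  · obtain ⟨i, -, rfl⟩ := mem_UMultiset.1 h
    exact hpow i
  · obtain ⟨i, -, hi⟩ := mem_UMultiset.1 h
    have := hneg _ (hpow i)
    rwa [hi, neg_neg] at this

end UMultiset

section Torsion

variable {G : Type*} [AddCommGroup G]

lemma isOfFinAddOrder_of_double_mem {D : Multiset G} (hdouble : ∀ x ∈ D, x + x ∈ D) {g : G}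
    (hg : g ∈ D) : IsOfFinAddOrder g := by
  classical
  have hpow : ∀ i : ℕ, 2 ^ i • g ∈ D := by
    intro i
    induction i with
    | zero => simpa using hg
    | succ i ih =>
      rw [pow_succ, mul_two, add_nsmul]
      exact hdouble _ ih
  by_contra h
  have hinj : Function.Injective fun i : ℕ => 2 ^ i • g :=
    (injective_nsmul_iff_not_isOfFinAddOrder.2 h).comp (Nat.pow_right_injective le_rfl)
  refine Set.infinite_of_injective_forall_mem hinj (s := {x | x ∈ D.toFinset}) (fun i => ?_)
    D.toFinset.finite_toSet
  exact Multiset.mem_toFinset.2 (hpow i)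

lemma odd_addOrderOf (h2 : ∀ g : G, g + g = 0 → g = 0) {g : G} (hg : IsOfFinAddOrder g) :
    Odd (addOrderOf g) := by
  by_contra h
  obtain ⟨m, hm⟩ := Nat.not_odd_iff_even.1 h
  have hmg : m • g = 0 := h2 _ (by rw [← add_nsmul, ← hm, addOrderOf_nsmul_eq_zero])
  have hpos := hg.addOrderOf_pos
  have := Nat.le_of_dvd (by omega) (addOrderOf_dvd_of_nsmul_eq_zero hmg)
  omega

lemma exists_zmod_embedding {g h : G} (hg : IsOfFinAddOrder g)
    (hh : h ∈ AddSubgroup.zmultiples g) (heq : addOrderOf h = addOrderOf g) :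
    ∃ (ι : ZMod (addOrderOf g) →+ G) (β : (ZMod (addOrderOf g))ˣ),
      Function.Injective ι ∧ ι 1 = g ∧ ι β = h := by
  let f : {f : ℤ →+ G // f (addOrderOf g) = 0} := ⟨zmultiplesHom G g, by simp⟩
  have hι : ∀ k : ℕ, ZMod.lift (addOrderOf g) f (k : ZMod (addOrderOf g)) = k • g := by
    intro k
    have := ZMod.lift_coe (addOrderOf g) f k
    simpa [f] using this
  obtain ⟨k, rfl⟩ := (hg.mem_multiples_iff_mem_zmultiples).2 hh
  have hk : k.Coprime (addOrderOf g) := by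
    have hdvd := Nat.gcd_dvd_left (addOrderOf g) k
    have hpos := hg.addOrderOf_pos
    change addOrderOf (k • g) = _ at heq
    rw [hg.addOrderOf_nsmul, Nat.div_eq_self] at heq
    rw [Nat.coprime_comm]
    exact heq.resolve_left hpos.ne'
  refine ⟨ZMod.lift _ f, ZMod.unitOfCoprime k hk, ?_, ?_, ?_⟩
  · refine (ZMod.lift_injective _).2 fun m hm => ?_
    rw [ZMod.intCast_zmod_eq_zero_iff_dvd]
    exact addOrderOf_dvd_iff_zsmul_eq_zero.2 (by simpa [f] using hm)
  · simpa using hι 1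
  · simpa using hι k

end Torsion

section Reduction

variable {G : Type*} [AddCommGroup G] [DecidableEq G]

open Classical in
lemma exists_isMove_pair {X Y : Multiset G} (hX : ∀ x ∈ X - Y, IsOfFinAddOrder x)
    (hH : ∀ H : AddSubgroup G, X.countP (· ∈ H) = Y.countP (· ∈ H)) (hne : X - Y ≠ 0) :
    ∃ g ∈ X - Y, ∃ h ∈ Y - X, h ∈ AddSubgroup.zmultiples g ∧ addOrderOf h = addOrderOf g := by
  have hsub : ∀ H : AddSubgroup G, (X - Y).countP (· ∈ H) = (Y - X).countP (· ∈ H) := by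
    intro H
    have h1 := congrArg (Multiset.countP (· ∈ H)) (Multiset.sub_add_inter X Y)
    have h3 := congrArg (Multiset.countP (· ∈ H)) (Multiset.sub_add_inter Y X)
    rw [Multiset.countP_add] at h1 h3
    rw [Multiset.inter_comm] at h3
    have := hH H
    omega
  obtain ⟨g, hg, hmin⟩ := (X - Y).toFinset.exists_min_image addOrderOf
    (Multiset.toFinset_nonempty.2 hne)
  simp only [Multiset.mem_toFinset] at hg hmin
  have hpos : 0 < (Y - X).countP (· ∈ AddSubgroup.zmultiples g) :=
    hsub _ ▸ Multiset.countP_pos.2 ⟨g, hg, AddSubgroup.mem_zmultiples g⟩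
  obtain ⟨h, hh, hhg⟩ := Multiset.countP_pos.1 hpos
  have hpos' : 0 < (X - Y).countP (· ∈ AddSubgroup.zmultiples h) :=
    hsub _ ▸ Multiset.countP_pos.2 ⟨h, hh, AddSubgroup.mem_zmultiples h⟩
  obtain ⟨g', hg', hgh'⟩ := Multiset.countP_pos.1 hpos'
  have hd1 : addOrderOf h ∣ addOrderOf g := addOrderOf_dvd_of_mem_zmultiples hhg
  have hd2 : addOrderOf g' ∣ addOrderOf h := addOrderOf_dvd_of_mem_zmultiples hgh'
  have hgpos := (hX g hg).addOrderOf_pos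
  have hhpos := Nat.pos_of_dvd_of_pos hd1 hgpos
  exact ⟨g, hg, h, hh, hhg, le_antisymm (Nat.le_of_dvd hgpos hd1)
    ((hmin g' hg').trans (Nat.le_of_dvd hhpos hd2))⟩

lemma double_mem_sub {X Y : Multiset G}
    (hd : ∀ x, X.count x + Y.count (x + x) = X.count (x + x) + Y.count x) :
    ∀ x ∈ X - Y, x + x ∈ X - Y := by
  intro x hx
  rw [← Multiset.count_pos, Multiset.count_sub] at hx ⊢
  have := hd x
  omega

lemma neg_mem_symmetrize_sub (A B : Multiset G) :
    ∀ x ∈ symmetrize A - symmetrize B, -x ∈ symmetrize A - symmetrize B := by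
  intro x hx
  rw [← Multiset.count_pos, Multiset.count_sub, count_symmetrize, count_symmetrize] at hx ⊢
  rw [neg_neg]
  omega

open Classical in
lemma reflTransGen_isMove (h2 : ∀ g : G, g + g = 0 → g = 0) (A B : Multiset G)
    (hd : ∀ x, (symmetrize A).count x + (symmetrize B).count (x + x) =
      (symmetrize A).count (x + x) + (symmetrize B).count x)
    (hH : ∀ H : AddSubgroup G,
      (symmetrize A).countP (· ∈ H) = (symmetrize B).countP (· ∈ H)) :
    Relation.ReflTransGen IsMove A B := by
  induction hN : (symmetrize A - symmetrize B).card using Nat.strong_induction_on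
    generalizing A with
  | _ N ih =>
  by_cases hne : symmetrize A - symmetrize B = 0
  · refine reflTransGen_isMove_of_symmetrize_eq A B
      (Multiset.eq_of_le_of_card_le (tsub_eq_zero_iff_le.1 hne) ?_)
    have := hH ⊤
    simp only [AddSubgroup.mem_top, Multiset.countP_True] at this
    exact this.ge
  have hdA := double_mem_sub hd
  have hdB := double_mem_sub (X := symmetrize B) (Y := symmetrize A)
    fun x => by have := hd x; omega
  obtain ⟨g, hg, h, hh, hhg, heq⟩ :=
    exists_isMove_pair (fun x hx => isOfFinAddOrder_of_double_mem hdA hx) hH hne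
  have hfin := isOfFinAddOrder_of_double_mem hdA hg
  have hodd := odd_addOrderOf h2 hfin
  have hn3 : 3 ≤ addOrderOf g := by
    by_contra hlt
    obtain ⟨m, hm⟩ := hodd
    have h1 : addOrderOf g = 1 := by omega
    rw [h1, AddMonoid.addOrderOf_eq_one_iff] at heq
    rw [AddMonoid.addOrderOf_eq_one_iff] at h1
    subst heq h1
    rw [← Multiset.count_pos, Multiset.count_sub] at hg hh
    omega
  obtain ⟨ι, β, hι, hι1, hιβ⟩ := exists_zmod_embedding hfin hhg heq
  generalize addOrderOf g = n at *
  have hWA : symmetrize (UMultiset n 1 ι) ≤ symmetrize A - symmetrize B :=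
    symmetrize_UMultiset_le hodd hn3 hι (neg_mem_symmetrize_sub A B) hdA (by simpa [hι1] using hg)
  have hWB : symmetrize (UMultiset n β ι) ≤ symmetrize B - symmetrize A :=
    symmetrize_UMultiset_le hodd hn3 hι (neg_mem_symmetrize_sub B A) hdB (hιβ ▸ hh)
  obtain ⟨C, hC⟩ := exists_symmetrize_add_eq _ _ (hWA.trans (Multiset.sub_le_self _ _))
  have hmove : IsMove (UMultiset n 1 ι + C) (UMultiset n β ι + C) := by
    refine .inr ⟨n, hodd, hn3, 1, β, ι, hι, Multiset.le_add_right _ _, ?_⟩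
    rw [add_tsub_cancel_left, add_comm]
  refine ((reflTransGen_isMove_of_symmetrize_eq _ _ hC.symm).tail hmove).trans
    (ih _ ?_ (UMultiset n β ι + C) ?_ ?_ rfl)
  · have hsub : symmetrize (UMultiset n β ι + C) - symmetrize B =
        symmetrize A - symmetrize B - symmetrize (UMultiset n 1 ι) := by
      ext x
      have hA := Multiset.le_iff_count.1 hWA x
      have hB := Multiset.le_iff_count.1 hWB x
      have hCx := congrArg (Multiset.count x) hC
      simp only [symmetrize_add, Multiset.count_add, Multiset.count_sub] at *
      omega
    have hmem : g ∈ symmetrize (UMultiset n 1 ι) :=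
      mem_symmetrize.2 (.inl (mem_UMultiset.2 ⟨0, (upow_spec hodd).1, by simpa using hι1⟩))
    have hpos := Multiset.card_pos_iff_exists_mem.2 ⟨g, hmem⟩
    have hle := Multiset.card_le_card hWA
    rw [hsub, Multiset.card_sub hWA]
    omega
  · intro x
    have hx := hd x
    rw [← hC] at hx
    simp only [symmetrize_add, Multiset.count_add,
      count_double_symmetrize_UMultiset h2 hodd hn3 hι] at hx ⊢
    omega
  · intro H
    have hx := hH H
    rw [← hC] at hx
    rw [← hx]
    simp only [symmetrize_add, Multiset.countP_add, countP_symmetrize,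
      countP_UMultiset hodd H 1 β]

lemma finsum_mem_count_sub (A B : Multiset G) (H : AddSubgroup G) [DecidablePred (· ∈ H)] :
    ∑ᶠ g ∈ (H : Set G), ((A.count g : ℤ) - (B.count g : ℤ)) =
      (A.countP (· ∈ H) : ℤ) - B.countP (· ∈ H) := by
  have hcount : ∀ C : Multiset G, (∀ x ∈ C, x ∈ (A + B).toFinset) →
      C.countP (· ∈ H) = ∑ x ∈ (A + B).toFinset, if x ∈ H then C.count x else 0 := by
    intro C hC
    rw [Multiset.countP_eq_card_filter, ← Multiset.sum_count_eq_card
      (s := (A + B).toFinset) fun x hx => hC x (Multiset.mem_of_mem_filter hx)]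
    simp only [Multiset.count_filter]
  rw [hcount A fun x hx => by simp [hx], hcount B fun x hx => by simp [hx],
    finsum_mem_def, finsum_eq_sum_of_support_subset (s := (A + B).toFinset)]
  · push_cast
    rw [← Finset.sum_sub_distrib]
    refine Finset.sum_congr rfl fun x _ => ?_
    by_cases hx : x ∈ H <;> simp [hx]
  · intro x hx
    by_contra hx'
    simp only [Finset.mem_coe, Multiset.mem_toFinset, Multiset.mem_add, not_or] at hx'
    simp [Multiset.count_eq_zero_of_notMem hx'.1,
      Multiset.count_eq_zero_of_notMem hx'.2] at hx

end Reduction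

lemma Relation.ReflTransGen.exists_seq {α : Type*} {r : α → α → Prop} {a b : α}
    (h : Relation.ReflTransGen r a b) :
    ∃ (m : ℕ) (E : ℕ → α), E 0 = a ∧ E m = b ∧ ∀ i < m, r (E i) (E (i + 1)) := by
  induction h using Relation.ReflTransGen.head_induction_on with
  | refl => exact ⟨0, fun _ => b, rfl, rfl, by simp⟩
  | @head a c hac _ ih =>
    obtain ⟨m, E, h0, hm, hE⟩ := ih
    refine ⟨m + 1, fun i => Nat.casesOn i a E, rfl, hm, fun i hi => ?_⟩
    cases i with
    | zero => simpa [h0] using hac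
    | succ i => exact hE i (by omega)

theorem stmt8 {G : Type*} [AddCommGroup G] [DecidableEq G]
    (h2 : ∀ g : G, g + g = 0 → g = 0) (A B : Multiset G)
    (h : memV (fun g => (A.count g : ℤ) - (B.count g : ℤ))) :
    ∃ (m : ℕ) (E : ℕ → Multiset G), E 0 = A ∧ E m = B ∧
      ∀ i < m, IsMove (E i) (E (i + 1)) := by
  classical
  obtain ⟨-, hd, hH⟩ := h
  refine (reflTransGen_isMove h2 A B (fun x => ?_) fun H => ?_).exists_seq
  · have := hd x
    beta_reduce at this
    simp only [count_symmetrize]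
    omega
  · have := hH H
    rw [finsum_mem_count_sub] at this
    rw [countP_symmetrize, countP_symmetrize]
    omega
end

section
/- Let n be an odd natural number, let A, B be finite multisets of ℤ/nℤ, let s ∈ ℤ/nℤ, and write μ := μ_A − μ_B. Then FS(A) = FS(B) + s if and only if for every divisor d of n, ∏_{j ∈ ℤ/nℤ} (1 + ω_d^j)^{μ(j)} = ω_d^s, where ω_d := e^{2πi/d} ∈ ℂ (and ω_d^j is well defined since the exponents are taken modulo n, a multiple of d). -/
open scoped BigOperators

/-- The multiset of all `2^|A|` subset sums of a finite multiset `A`. -/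
def FS {G : Type*} [AddCommMonoid G] (A : Multiset G) : Multiset G :=
  A.powerset.map Multiset.sum

/-- `ω_d = e^{2πi/d}`. -/
noncomputable def omegaC (d : ℕ) : ℂ := Complex.exp (2 * Real.pi * Complex.I / d)

theorem sum_map_FS {G R : Type*} [AddCommMonoid G] [CommSemiring R] (f : G → R) (h0 : f 0 = 1)
    (hadd : ∀ x y, f (x + y) = f x * f y) (A : Multiset G) :
    ((FS A).map f).sum = (A.map fun a => 1 + f a).prod := by
  unfold FS
  induction A using Multiset.induction_on with
  | empty => simp [h0]
  | cons a A ih =>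
    simp only [Multiset.map_map, Function.comp_def] at ih ⊢
    simp only [Multiset.powerset_cons, Multiset.map_add, Multiset.map_map, Function.comp_def,
      Multiset.sum_cons, Multiset.sum_add, hadd, Multiset.sum_map_mul_left, ih,
      Multiset.map_cons, Multiset.prod_cons]
    ring

theorem prod_zpow_count_sub {G K : Type*} [Fintype G] [DecidableEq G] [Field K] (g : G → K)
    (hg : ∀ x, g x ≠ 0) (A B : Multiset G) :
    ∏ j : G, g j ^ ((A.count j : ℤ) - (B.count j : ℤ)) = (A.map g).prod / (B.map g).prod := by
  have key (C : Multiset G) : (C.map g).prod = ∏ j : G, g j ^ C.count j := by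
    rw [Finset.prod_multiset_map_count]
    refine Finset.prod_subset (Finset.subset_univ _) fun x _ hx => ?_
    rw [Multiset.mem_toFinset] at hx
    simp [Multiset.count_eq_zero.2 hx]
  simp [key, zpow_sub₀ (hg _), Finset.prod_div_distrib]

theorem isPrimitiveRoot_omegaC {d : ℕ} (hd : d ≠ 0) : IsPrimitiveRoot (omegaC d) d :=
  Complex.isPrimitiveRoot_exp d hd

theorem pow_val_add {M : Type*} [Monoid M] {n : ℕ} [NeZero n] {z : M} (hz : z ^ n = 1)
    (x y : ZMod n) : z ^ (x + y).val = z ^ x.val * z ^ y.val := by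
  rw [ZMod.val_add, ← pow_add, ← pow_eq_pow_mod _ hz]

theorem one_add_pow_ne_zero {K : Type*} [Field K] [CharZero K] {n : ℕ} (hn : Odd n) {z : K}
    (hz : z ^ n = 1) (k : ℕ) : 1 + z ^ k ≠ 0 := by
  intro h
  have h1 : z ^ k = -1 := by linear_combination h
  have h2 : (z ^ k) ^ n = 1 := by rw [← pow_mul, mul_comm, pow_mul, hz, one_pow]
  rw [h1, hn.neg_one_pow] at h2
  norm_num at h2

open Polynomial in
/-- The polynomial of degree less than `n` whose coefficients are the multiplicities of `S`. -/
noncomputable def multiplicityPoly {n : ℕ} (S : Multiset (ZMod n)) : ℚ[X] :=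
  (S.map fun x => (X : ℚ[X]) ^ x.val).sum

open Polynomial in
theorem coeff_multiplicityPoly {n : ℕ} [NeZero n] (S : Multiset (ZMod n)) (x : ZMod n) :
    (multiplicityPoly S).coeff x.val = S.count x := by
  unfold multiplicityPoly
  induction S using Multiset.induction_on with
  | empty => simp
  | cons a S ih =>
    simp only [Multiset.map_cons, Multiset.sum_cons, coeff_add, ih, coeff_X_pow,
      Multiset.count_cons, (ZMod.val_injective n).eq_iff]
    push_cast
    ring

open Polynomial in
theorem degree_multiplicityPoly_lt {n : ℕ} [NeZero n] (S : Multiset (ZMod n)) :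
    (multiplicityPoly S).degree < n := by
  rw [← mem_degreeLT]
  refine multiset_sum_mem _ fun p hp => ?_
  obtain ⟨x, -, rfl⟩ := Multiset.mem_map.1 hp
  rw [mem_degreeLT, degree_X_pow]
  exact_mod_cast x.val_lt

open Polynomial in
theorem aeval_multiplicityPoly {n : ℕ} (S : Multiset (ZMod n)) (z : ℂ) :
    aeval z (multiplicityPoly S) = (S.map fun x => z ^ x.val).sum := by
  simp [multiplicityPoly, map_multiset_sum, Multiset.map_map]

open Polynomial in
/-- A rational polynomial of degree less than `n` is zero once it vanishes at one primitive
`d`-th root of unity for each divisor `d` of `n`. -/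
theorem eq_zero_of_aeval_omegaC_eq_zero {n : ℕ} (hn : n ≠ 0) {p : ℚ[X]} (hp : p.degree < n)
    (h : ∀ d, d ∣ n → aeval (omegaC d) p = 0) : p = 0 := by
  have hdvd : (X ^ n - 1 : ℚ[X]) ∣ p := by
    rw [← prod_cyclotomic_eq_X_pow_sub_one (Nat.pos_of_ne_zero hn) ℚ]
    refine Finset.prod_dvd_of_coprime (fun a _ b _ hab => cyclotomic.isCoprime_rat hab)
      fun d hd => ?_
    have hd' : d ∣ n := Nat.dvd_of_mem_divisors hd
    have hpos : 0 < d := Nat.pos_of_mem_divisors hd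
    rw [cyclotomic_eq_minpoly_rat (isPrimitiveRoot_omegaC hpos.ne') hpos]
    exact minpoly.dvd _ _ (h d hd')
  refine eq_zero_of_dvd_of_degree_lt hdvd ?_
  rwa [← C_1, degree_X_pow_sub_C (Nat.pos_of_ne_zero hn)]

theorem eq_iff_forall_sum_omegaC_pow_eq {n : ℕ} [NeZero n] (S T : Multiset (ZMod n)) :
    S = T ↔ ∀ d, d ∣ n →
      (S.map fun x => omegaC d ^ x.val).sum = (T.map fun x => omegaC d ^ x.val).sum := by
  refine ⟨fun h _ _ => by rw [h], fun h => ?_⟩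
  have hpoly : multiplicityPoly S - multiplicityPoly T = 0 := by
    refine eq_zero_of_aeval_omegaC_eq_zero (NeZero.ne n) ?_ fun d hd => ?_
    · exact (Polynomial.degree_sub_le _ _).trans_lt
        (max_lt (degree_multiplicityPoly_lt S) (degree_multiplicityPoly_lt T))
    · rw [map_sub, aeval_multiplicityPoly, aeval_multiplicityPoly, h d hd, sub_self]
  ext x
  have hx := coeff_multiplicityPoly S x
  rw [sub_eq_zero.1 hpoly, coeff_multiplicityPoly] at hx
  exact_mod_cast hx.symm

theorem stmt10 (n : ℕ) [NeZero n] (hn : Odd n) (A B : Multiset (ZMod n)) (s : ZMod n) :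
    FS A = (FS B).map (fun x => x + s) ↔
      ∀ d : ℕ, d ∣ n →
        (∏ j : ZMod n, (1 + omegaC d ^ j.val) ^ ((A.count j : ℤ) - (B.count j : ℤ))) =
          omegaC d ^ s.val := by
  rw [eq_iff_forall_sum_omegaC_pow_eq]
  refine forall₂_congr fun d hd => ?_
  have hd0 : d ≠ 0 := ne_zero_of_dvd_ne_zero (NeZero.ne n) hd
  have hz : omegaC d ^ n = 1 := ((isPrimitiveRoot_omegaC hd0).pow_eq_one_iff_dvd n).2 hd
  have hne (x : ZMod n) : 1 + omegaC d ^ x.val ≠ 0 := one_add_pow_ne_zero hn hz _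
  have hB : (B.map fun x => 1 + omegaC d ^ x.val).prod ≠ 0 := by
    simp [Multiset.prod_eq_zero_iff, hne]
  have hFS := sum_map_FS (fun x : ZMod n => omegaC d ^ x.val) (by simp) (pow_val_add hz)
  rw [prod_zpow_count_sub (fun j : ZMod n => 1 + omegaC d ^ j.val) hne, div_eq_iff hB, hFS,
    Multiset.map_map]
  simp only [Function.comp_def, pow_val_add hz, Multiset.sum_map_mul_right, hFS]
  rw [mul_comm]
end

section
/- Let n ≥ 1 be an odd natural number and r ≥ 1 a natural number. If A, B are finite multisets of (ℤ/nℤ)^r such that FS(A) = FS(B) + s for some s ∈ (ℤ/nℤ)^r, then μ_A − μ_B ∈ V((ℤ/nℤ)^r). -/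
open scoped BigOperators

section

open Filter Topology Finset

theorem sum_range_smul_eq_of_partial_sums (w : ℕ → ℝ) (b : ℕ → ℂ) (n : ℕ) :
    ∑ k ∈ range n, w k • b k = w n • ∑ i ∈ range n, b i
      + ∑ k ∈ range n, (w k - w (k + 1)) • ∑ i ∈ range (k + 1), b i := by
  induction n with
  | zero => simp
  | succ n ih =>
    rw [sum_range_succ, ih, sum_range_succ (fun k ↦ (w k - w (k + 1)) • _) n, sum_range_succ b n]
    simp only [smul_add, sub_smul]
    abel

theorem rpow_neg_sub_le {s : ℝ} (h1 : 1 ≤ s) (h2 : s ≤ 2) (k : ℕ) :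
    |((k : ℝ) + 1) ^ (-s) - ((k : ℝ) + 1 + 1) ^ (-s)| ≤ 2 * (((k + 1 : ℕ) : ℝ) ^ 2)⁻¹ := by
  set x : ℝ := k + 1 with hx
  have hx1 : (1 : ℝ) ≤ x := by simp [hx]
  have hx0 : 0 < x := by linarith
  have hy0 : 0 < x + 1 := by linarith
  have hle : (x + 1) ^ (-s) ≤ x ^ (-s) :=
    Real.rpow_le_rpow_of_nonpos hx0 (by linarith) (by linarith)
  have hq : (x + 1) ^ (-s) = x ^ (-s) * (x / (x + 1)) ^ s := by
    rw [Real.div_rpow hx0.le hy0.le, Real.rpow_neg hx0.le, Real.rpow_neg hy0.le]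
    have := (Real.rpow_pos_of_pos hx0 s).ne'
    field_simp
  have hr : (x / (x + 1)) ^ (2 : ℝ) ≤ (x / (x + 1)) ^ s :=
    Real.rpow_le_rpow_of_exponent_ge (by positivity) ((div_le_one hy0).2 (by linarith)) h2
  have hs : x ^ (-s) ≤ x⁻¹ := by
    rw [← Real.rpow_neg_one]
    exact Real.rpow_le_rpow_of_exponent_le hx1 (by linarith)
  have hd : 1 - (x / (x + 1)) ^ s ≤ 2 * x⁻¹ := by
    have : 1 - (x / (x + 1)) ^ (2 : ℝ) ≤ 2 * x⁻¹ := by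
      rw [Real.rpow_two]
      have h3 : 2 * x⁻¹ - (1 - (x / (x + 1)) ^ 2) = (3 * x + 2) / (x * (x + 1) ^ 2) := by
        field_simp
        ring
      have : 0 ≤ (3 * x + 2) / (x * (x + 1) ^ 2) := by positivity
      linarith
    linarith
  rw [abs_of_nonneg (by linarith), hq]
  have : ((k + 1 : ℕ) : ℝ) = x := by push_cast; rfl
  rw [this]
  have h0 : 0 ≤ 1 - (x / (x + 1)) ^ s := by
    have := Real.rpow_le_one (by positivity : 0 ≤ x / (x + 1)) ((div_le_one hy0).2 (by linarith))
      (by linarith : 0 ≤ s)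
    linarith
  calc x ^ (-s) - x ^ (-s) * (x / (x + 1)) ^ s = x ^ (-s) * (1 - (x / (x + 1)) ^ s) := by ring
    _ ≤ x⁻¹ * (2 * x⁻¹) := mul_le_mul hs hd h0 (by positivity)
    _ = 2 * (x ^ 2)⁻¹ := by field_simp

/-- If `b` has bounded partial sums, then `∑ b k / (k + 1)` converges, and its sum is the limit of
the Dirichlet series `∑ b k / (k + 1) ^ s` as `s` decreases to `1`. -/
theorem exists_tendsto_sum_and_tendsto_dirichlet {b : ℕ → ℂ} {C : ℝ}
    (hb : ∀ n, ‖∑ i ∈ range n, b i‖ ≤ C) :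
    ∃ T : ℂ, Tendsto (fun n ↦ ∑ k ∈ range n, ((k : ℝ) + 1)⁻¹ • b k) atTop (𝓝 T) ∧
      ∀ F : ℝ → ℂ, (∀ s, 1 < s → HasSum (fun k : ℕ ↦ ((k : ℝ) + 1) ^ (-s) • b k) (F s)) →
        Tendsto F (𝓝[>] 1) (𝓝 T) := by
  set U : ℝ → ℕ → ℂ := fun s k ↦
    (((k : ℝ) + 1) ^ (-s) - ((k : ℝ) + 1 + 1) ^ (-s)) • ∑ i ∈ range (k + 1), b i with hU
  have hbound (s : ℝ) (h1 : 1 ≤ s) (h2 : s ≤ 2) (k : ℕ) :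
      ‖U s k‖ ≤ 2 * (((k + 1 : ℕ) : ℝ) ^ 2)⁻¹ * C := by
    rw [hU, norm_smul]
    exact mul_le_mul (rpow_neg_sub_le h1 h2 k) (hb _) (norm_nonneg _) (by positivity)
  have hsum : Summable (fun k : ℕ ↦ 2 * (((k + 1 : ℕ) : ℝ) ^ 2)⁻¹ * C) :=
    (((summable_nat_add_iff 1).2 (Real.summable_nat_pow_inv.2 one_lt_two)).mul_left 2).mul_right C
  have hpart (s : ℝ) (h1 : 1 ≤ s) (h2 : s ≤ 2) :
      Tendsto (fun n ↦ ∑ k ∈ range n, ((k : ℝ) + 1) ^ (-s) • b k) atTop (𝓝 (∑' k, U s k)) := by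
    have hw : Tendsto (fun n : ℕ ↦ ((n : ℝ) + 1) ^ (-s)) atTop (𝓝 0) :=
      (tendsto_rpow_neg_atTop (by linarith)).comp
        (tendsto_atTop_add_const_right _ _ tendsto_natCast_atTop_atTop)
    have h0 : Tendsto (fun n : ℕ ↦ ((n : ℝ) + 1) ^ (-s) • ∑ i ∈ range n, b i) atTop (𝓝 (0 : ℂ)) :=
      hw.zero_smul_isBoundedUnder_le (isBoundedUnder_of ⟨C, hb⟩)
    have h3 := (Summable.of_norm_bounded hsum (hbound s h1 h2)).hasSum.tendsto_sum_nat
    have h4 := h0.add h3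
    rw [zero_add] at h4
    refine h4.congr fun n ↦ ?_
    have := sum_range_smul_eq_of_partial_sums (fun k ↦ ((k : ℝ) + 1) ^ (-s)) b n
    rw [this]
    simp [hU]
  refine ⟨∑' k, U 1 k, ?_, fun F hF ↦ ?_⟩
  · simpa [Real.rpow_neg_one] using hpart 1 le_rfl one_le_two
  · have hnhds : ∀ᶠ s : ℝ in 𝓝[>] 1, 1 < s ∧ s ≤ 2 := by
      filter_upwards [Ioc_mem_nhdsGT (one_lt_two : (1 : ℝ) < 2)] with s hs using hs
    have hlim : Tendsto (fun s ↦ ∑' k, U s k) (𝓝[>] 1) (𝓝 (∑' k, U 1 k)) := by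
      refine tendsto_tsum_of_dominated_convergence hsum (fun k ↦ ?_)
        (hnhds.mono fun s hs k ↦ hbound s hs.1.le hs.2 k)
      refine (Continuous.tendsto ?_ 1).mono_left nhdsWithin_le_nhds
      have h1 : ((k : ℝ) + 1) ≠ 0 := by positivity
      have h2 : ((k : ℝ) + 1 + 1) ≠ 0 := by positivity
      simp only [hU]
      refine Continuous.smul (f := fun s : ℝ ↦ ((k : ℝ) + 1) ^ (-s) - ((k : ℝ) + 1 + 1) ^ (-s))
        (Continuous.sub ?_ ?_) continuous_const
      · exact continuous_const.rpow continuous_neg fun _ ↦ .inl h1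
      · exact continuous_const.rpow continuous_neg fun _ ↦ .inl h2
    refine hlim.congr' (hnhds.mono fun s hs ↦ ?_)
    exact tendsto_nhds_unique (hpart s hs.1.le hs.2) (hF s hs.1).tendsto_sum_nat

theorem one_add_mem_slitPlane {ζ : ℂ} (hζ : ‖ζ‖ = 1) (h : 1 + ζ ≠ 0) :
    1 + ζ ∈ Complex.slitPlane := by
  have hre : -1 ≤ ζ.re := by
    have := Complex.abs_re_le_norm ζ
    rw [hζ] at this
    exact (abs_le.1 this).1
  rcases hre.lt_or_eq with h' | h'
  · left; simp; linarith
  · exfalso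
    have h2 : ζ.im = 0 := by
      have := Complex.normSq_eq_norm_sq ζ
      rw [hζ, Complex.normSq_apply, ← h'] at this
      nlinarith
    exact h (Complex.ext (by simp [← h']) (by simp [h2]))

/-- The alternating polylogarithm `∑ (-1) ^ (m + 1) ζ ^ m / m ^ s` tends to `log (1 + ζ)` as `s`
decreases to `1`. -/
theorem tendsto_LSeries_neg_one_pow_mul_pow {ζ : ℂ} (hζ : ‖ζ‖ = 1) (h : 1 + ζ ≠ 0) :
    Tendsto (fun s : ℝ ↦ LSeries (fun m ↦ (-1) ^ (m + 1) * ζ ^ m) s) (𝓝[>] 1)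
      (𝓝 (Complex.log (1 + ζ))) := by
  set b : ℕ → ℂ := fun k ↦ (-1) ^ (k + 1 + 1) * ζ ^ (k + 1) with hbdef
  have hgeom (k : ℕ) : b k = ζ * (-ζ) ^ k := by
    rw [hbdef, neg_pow ζ]; ring
  have hb (n : ℕ) : ‖∑ i ∈ range n, b i‖ ≤ 2 / ‖1 + ζ‖ := by
    simp only [hgeom, ← mul_sum]
    have hne : -ζ ≠ 1 := fun h' ↦ h (by rw [← h']; ring)
    rw [geom_sum_eq hne, norm_mul, hζ, one_mul, norm_div]
    have h1 : ‖-ζ - 1‖ = ‖1 + ζ‖ := by rw [← norm_neg]; congr 1; ring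
    rw [h1]
    gcongr
    calc ‖(-ζ) ^ n - 1‖ ≤ ‖(-ζ) ^ n‖ + ‖(1 : ℂ)‖ := norm_sub_le _ _
      _ = 2 := by rw [norm_pow, norm_neg, hζ]; norm_num
  obtain ⟨T, hT, hF⟩ := exists_tendsto_sum_and_tendsto_dirichlet hb
  have hlog : T = Complex.log (1 + ζ) := by
    have hT' : Tendsto (fun n ↦ ∑ m ∈ range n, (-1) ^ (m + 1) * ζ ^ m / (m : ℂ)) atTop (𝓝 T) := by
      rw [← tendsto_add_atTop_iff_nat 1]
      refine hT.congr fun n ↦ ?_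
      rw [sum_range_succ']
      simp only [Nat.cast_zero, div_zero, add_zero]
      refine sum_congr rfl fun k _ ↦ ?_
      rw [Complex.real_smul, hbdef]
      push_cast
      ring
    have h1 := Complex.tendsto_tsum_powerSeries_nhdsWithin_lt hT'
    rw [tendsto_map'_iff] at h1
    refine tendsto_nhds_unique h1 ?_
    have hslit := one_add_mem_slitPlane hζ h
    have hc : Tendsto (fun x : ℝ ↦ Complex.log (1 + x * ζ)) (𝓝[<] 1)
        (𝓝 (Complex.log (1 + ζ))) := by
      have : ContinuousAt (fun x : ℝ ↦ Complex.log (1 + x * ζ)) 1 := by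
        refine ContinuousAt.clog (by fun_prop) (by simpa using hslit)
      simpa using this.tendsto.mono_left nhdsWithin_le_nhds
    refine hc.congr' ?_
    filter_upwards [Ioo_mem_nhdsLT (zero_lt_one : (0 : ℝ) < 1)] with x hx
    have hx' : ‖(x : ℂ) * ζ‖ < 1 := by
      rw [norm_mul, hζ, mul_one, Complex.norm_real, Real.norm_of_nonneg hx.1.le]
      exact hx.2
    rw [← (Complex.hasSum_taylorSeries_log hx').tsum_eq]
    refine tsum_congr fun m ↦ ?_
    rw [mul_pow]
    ring
  rw [← hlog]
  refine hF _ fun s hs ↦ ?_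
  have hsm : LSeriesSummable (fun m ↦ (-1) ^ (m + 1) * ζ ^ m) (s : ℂ) :=
    LSeriesSummable_of_bounded_of_one_lt_real (m := 1) (fun n _ ↦ by simp [hζ]) hs
  have h1 := hsm.LSeriesHasSum
  rw [LSeriesHasSum, ← hasSum_nat_add_iff' 1] at h1
  simp only [range_one, sum_singleton, LSeries.term_zero, sub_zero] at h1
  refine h1.congr_fun fun k ↦ ?_
  rw [LSeries.term_of_ne_zero k.add_one_ne_zero, Complex.real_smul, hbdef,
    Complex.ofReal_cpow (by positivity)]
  push_cast
  rw [Complex.cpow_neg]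
  ring

theorem hasSum_even_LSeries_term {N : ℕ} (ψ : DirichletCharacter ℂ N) {s : ℂ} (hs : 1 < s.re) :
    HasSum (fun m ↦ if Even m then LSeries.term (ψ ·) s m else 0)
      (2 ^ (-s) * ψ 2 * LSeries (ψ ·) s) := by
  have h0 : HasSum (LSeries.term (ψ ·) s) (LSeries (ψ ·) s) :=
    (ψ.LSeriesSummable_of_one_lt_re hs).hasSum
  have h1 := h0.mul_left (2 ^ (-s) * ψ 2)
  refine ((mul_right_injective₀ (two_ne_zero' ℕ)).hasSum_iff fun m hm ↦ if_neg fun h ↦ ?_).1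
    (h1.congr_fun fun m ↦ ?_)
  · obtain ⟨k, rfl⟩ := h.two_dvd
    exact hm ⟨k, rfl⟩
  · rcases eq_or_ne m 0 with rfl | hm
    · simp
    · simp only [Function.comp_apply, even_two_mul, if_true]
      rw [LSeries.term_of_ne_zero hm, LSeries.term_of_ne_zero (by omega), Nat.cast_mul,
        Nat.cast_mul, map_mul, Complex.natCast_mul_natCast_cpow, Complex.cpow_neg]
      simp only [Nat.cast_ofNat]
      ring

theorem LSeries_alternating_mul_dirichletCharacter {N : ℕ} (ψ : DirichletCharacter ℂ N) {s : ℂ}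
    (hs : 1 < s.re) :
    LSeries (fun m ↦ (-1) ^ (m + 1) * ψ m) s = (1 - 2 * (2 ^ (-s) * ψ 2)) * LSeries (ψ ·) s := by
  have h0 : HasSum (LSeries.term (ψ ·) s) (LSeries (ψ ·) s) :=
    (ψ.LSeriesSummable_of_one_lt_re hs).hasSum
  have h1 := h0.sub ((hasSum_even_LSeries_term ψ hs).mul_left 2)
  have h2 (m : ℕ) : LSeries.term (fun m ↦ (-1) ^ (m + 1) * ψ m) s m =
      LSeries.term (ψ ·) s m - 2 * if Even m then LSeries.term (ψ ·) s m else 0 := by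
    rcases eq_or_ne m 0 with rfl | hm
    · simp
    · rw [LSeries.term_of_ne_zero hm, LSeries.term_of_ne_zero hm]
      split_ifs with h
      · rw [h.add_one.neg_one_pow]
        ring
      · rw [(Nat.not_even_iff_odd.1 h).add_one.neg_one_pow]
        ring
  rw [LSeries, (h1.congr_fun h2).tsum_eq]
  ring

theorem exists_tendsto_LSeries_alternating_ne_zero {N : ℕ} [NeZero N] (hN : Odd N)
    (ψ : DirichletCharacter ℂ N) (hψ : ψ = 1 ∨ ψ 2 ≠ 1) :
    ∃ κ : ℂ, κ ≠ 0 ∧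
      Tendsto (fun s : ℝ ↦ LSeries (fun m ↦ (-1) ^ (m + 1) * ψ m) s) (𝓝[>] 1) (𝓝 κ) := by
  have hcast : Tendsto (fun s : ℝ ↦ (s : ℂ)) (𝓝[>] 1) (𝓝[≠] 1) := by
    refine tendsto_nhdsWithin_of_tendsto_nhds_of_eventually_within _ ?_ ?_
    · exact (Complex.continuous_ofReal.tendsto' 1 1 (by simp)).mono_left nhdsWithin_le_nhds
    · filter_upwards [self_mem_nhdsWithin] with s hs
      simpa using (Set.mem_Ioi.1 hs).ne'
  have heq : (fun s : ℝ ↦ (1 - 2 * (2 ^ (-(s : ℂ)) * ψ 2)) * ψ.LFunction s) =ᶠ[𝓝[>] 1]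
      fun s : ℝ ↦ LSeries (fun m ↦ (-1) ^ (m + 1) * ψ m) s := by
    filter_upwards [self_mem_nhdsWithin] with s hs
    have hs' : 1 < (s : ℂ).re := by simpa using hs
    rw [LSeries_alternating_mul_dirichletCharacter ψ hs', ψ.LFunction_eq_LSeries hs']
  by_cases h1 : ψ = 1
  · subst h1
    have h2 : (1 : DirichletCharacter ℂ N) 2 = 1 := by
      refine MulChar.one_apply ?_
      exact_mod_cast (ZMod.isUnit_iff_coprime 2 N).2 (Nat.coprime_two_left.2 hN)
    have hres := (DirichletCharacter.LFunctionTrivChar_residue_one (N := N)).comp hcast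
    have hder : HasDerivAt (fun s : ℂ ↦ -(2 * (2 : ℂ) ^ (-s))) (Complex.log 2) 1 := by
      have := (((hasDerivAt_neg (1 : ℂ)).const_cpow (c := 2) (.inl two_ne_zero)).const_mul 2).neg
      refine this.congr_deriv ?_
      rw [Complex.cpow_neg_one]
      ring
    have hsl := (hasDerivAt_iff_tendsto_slope.1 hder).comp hcast
    refine ⟨_, ?_, (hsl.mul hres).congr' (EventuallyEq.trans ?_ heq)⟩
    · refine mul_ne_zero ?_ (prod_ne_zero_iff.2 fun p hp ↦ ?_)
      · rw [← Complex.ofReal_ofNat, ← Complex.ofReal_log zero_le_two]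
        exact_mod_cast (Real.log_pos one_lt_two).ne'
      · have := (Nat.prime_of_mem_primeFactors hp).one_lt
        rw [sub_ne_zero]
        intro h
        have : (p : ℂ) = 1 := by simpa using h.symm
        norm_cast at this
        omega
    · filter_upwards [self_mem_nhdsWithin] with s hs
      have : (s : ℂ) - 1 ≠ 0 := by
        rw [sub_ne_zero]
        exact_mod_cast (Set.mem_Ioi.1 hs).ne'
      simp only [Function.comp_apply, slope_def_field, h2, DirichletCharacter.LFunctionTrivChar,
        Complex.cpow_neg_one]
      field_simp
      ring
  · refine ⟨(1 - ψ 2) * ψ.LFunction 1, mul_ne_zero ?_ ?_, Tendsto.congr' heq ?_⟩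
    · exact sub_ne_zero.2 (hψ.resolve_left h1).symm
    · exact DirichletCharacter.LFunction_apply_one_ne_zero h1
    · have hc : Continuous (fun s : ℂ ↦ (1 - 2 * (2 ^ (-s) * ψ 2)) * ψ.LFunction s) := by
        have := (DirichletCharacter.differentiable_LFunction h1).continuous
        have h2 : Continuous fun s : ℂ ↦ (2 : ℂ) ^ (-s) :=
          continuous_neg.const_cpow (.inl two_ne_zero)
        fun_prop
      have := (hc.tendsto 1).comp (hcast.mono_right nhdsWithin_le_nhds)
      rw [Complex.cpow_neg_one] at this
      have h2 : 1 - ψ 2 = 1 - 2 * (2⁻¹ * ψ 2) := by ring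
      rw [h2]
      exact this

section FiniteGroup

variable {G : Type*} [AddCommGroup G]

theorem natCast_val_nsmul (b : G) (k : ℕ) :
    ((k : ZMod (addOrderOf b)).val) • b = k • b := by
  rw [nsmul_eq_nsmul_iff_modEq, ZMod.val_natCast]
  exact Nat.mod_modEq _ _

variable [Fintype G]

theorem one_add_addChar_ne_zero (hG : Odd (Fintype.card G)) (χ : AddChar G ℂ) (a : G) :
    1 + χ a ≠ 0 := by
  intro h
  have h1 : χ a = -1 := by linear_combination h
  have h2 := χ.map_nsmul_eq_pow (Fintype.card G) a
  rw [card_nsmul_eq_zero, AddChar.map_zero_eq_one, h1, hG.neg_one_pow] at h2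
  norm_num at h2

theorem sum_mul_log_one_add_eq_zero (hG : Odd (Fintype.card G)) {f : G → ℂ}
    (heven : ∀ a, f (-a) = f a) {χ : AddChar G ℂ}
    (h : ∑ a, f a * (Real.log ‖1 + χ a‖ : ℂ) = 0) :
    ∑ a, f a * Complex.log (1 + χ a) = 0 := by
  have h1 : ∑ a, f a * Complex.log (1 + χ (-a)) = ∑ a, f a * Complex.log (1 + χ a) := by
    rw [← Equiv.sum_comp (Equiv.neg G)]
    simp [heven]
  have h2 : ∑ a, f a * Complex.log (1 + χ a) + ∑ a, f a * Complex.log (1 + χ (-a)) =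
      2 * ∑ a, f a * (Real.log ‖1 + χ a‖ : ℂ) := by
    rw [← sum_add_distrib, mul_sum]
    refine sum_congr rfl fun a _ ↦ ?_
    have hs := one_add_mem_slitPlane (χ.norm_apply a) (one_add_addChar_ne_zero hG χ a)
    have hc : 1 + χ (-a) = (starRingEnd ℂ) (1 + χ a) := by
      rw [AddChar.map_neg_eq_conj, map_add, map_one]
    rw [hc, Complex.log_conj _ (Complex.slitPlane_arg_ne_pi hs), ← Complex.log_re]
    have hadd := Complex.add_conj (Complex.log (1 + χ a))
    push_cast at hadd
    linear_combination f a * hadd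
  rw [h1, h, mul_zero] at h2
  linear_combination h2 / 2

theorem nsmul_eq_val_nsmul_iff (b : G) (k : ℕ) (x : ZMod (addOrderOf b)) :
    k • b = x.val • b ↔ (k : ZMod (addOrderOf b)) = x := by
  have : NeZero (addOrderOf b) := ⟨(addOrderOf_pos b).ne'⟩
  rw [nsmul_eq_nsmul_iff_modEq, ← ZMod.natCast_eq_natCast_iff, ZMod.natCast_zmod_val]

/-- If `m • a` is a generator of `⟨b⟩` and the order of `a` does not exceed that of `b`, then `a`
is a generator of `⟨b⟩`. -/
theorem exists_unit_val_nsmul_eq {a b : G} {m : ℕ} {u : (ZMod (addOrderOf b))ˣ}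
    (ha : addOrderOf a ≤ addOrderOf b) (h : m • a = (u : ZMod (addOrderOf b)).val • b) :
    ∃ v : (ZMod (addOrderOf b))ˣ, (v : ZMod (addOrderOf b)).val • b = a := by
  have : NeZero (addOrderOf b) := ⟨(addOrderOf_pos b).ne'⟩
  have hu : addOrderOf ((u : ZMod (addOrderOf b)).val • b) = addOrderOf b :=
    Nat.Coprime.addOrderOf_nsmul (ZMod.val_coe_unit_coprime u).symm
  have hle : AddSubgroup.zmultiples (m • a) ≤ AddSubgroup.zmultiples a :=
    AddSubgroup.zmultiples_le_of_mem (AddSubgroup.nsmul_mem_zmultiples a m)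
  have heq := AddSubgroup.eq_of_le_of_card_ge hle (by
    rw [Nat.card_zmultiples, Nat.card_zmultiples, h, hu]; exact ha)
  have hmem : a ∈ AddSubgroup.zmultiples b := by
    have : a ∈ AddSubgroup.zmultiples (m • a) := heq ▸ AddSubgroup.mem_zmultiples a
    rw [h] at this
    exact AddSubgroup.zmultiples_le_of_mem (AddSubgroup.nsmul_mem_zmultiples b _) this
  rw [← mem_multiples_iff_mem_zmultiples] at hmem
  obtain ⟨k, rfl⟩ := hmem
  simp only at h
  rw [← mul_nsmul', nsmul_eq_val_nsmul_iff, Nat.cast_mul] at h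
  have hk : IsUnit (k : ZMod (addOrderOf b)) := isUnit_of_mul_isUnit_right (h ▸ u.isUnit)
  exact ⟨hk.unit, by simp⟩

theorem unit_val_nsmul_injective (b : G) :
    Function.Injective fun v : (ZMod (addOrderOf b))ˣ ↦ (v : ZMod (addOrderOf b)).val • b := by
  intro v w h
  have : NeZero (addOrderOf b) := ⟨(addOrderOf_pos b).ne'⟩
  simp only at h
  rw [nsmul_eq_val_nsmul_iff, ZMod.natCast_zmod_val] at h
  exact Units.ext h

open Classical in
theorem sum_dirichletCharacter_mul_sum_nsmul_eq {f : G → ℂ} {b : G}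
    (hf : ∀ a, addOrderOf b < addOrderOf a → f a = 0) [NeZero (addOrderOf b)]
    (ψ : DirichletCharacter ℂ (addOrderOf b)) (m : ℕ) :
    ∑ u : (ZMod (addOrderOf b))ˣ, ψ u *
        ∑ a, f a * (if m • a = (u : ZMod (addOrderOf b)).val • b then 1 else 0) =
      ψ m * ∑ v : (ZMod (addOrderOf b))ˣ, ψ v * f ((v : ZMod (addOrderOf b)).val • b) := by
  have h1 (u : (ZMod (addOrderOf b))ˣ) :
      ∑ a, f a * (if m • a = (u : ZMod (addOrderOf b)).val • b then 1 else 0) =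
      ∑ v : (ZMod (addOrderOf b))ˣ, f ((v : ZMod (addOrderOf b)).val • b) *
        (if (m * v : ZMod (addOrderOf b)) = u then 1 else 0) := by
    symm
    refine sum_of_injOn (fun v : (ZMod (addOrderOf b))ˣ ↦ (v : ZMod (addOrderOf b)).val • b)
      (unit_val_nsmul_injective b).injOn (by simp) (fun a _ ha ↦ ?_) (fun v _ ↦ ?_)
    · by_contra hne
      have hm : m • a = (u : ZMod (addOrderOf b)).val • b := by
        by_contra h
        simp [h] at hne
      have hle : addOrderOf a ≤ addOrderOf b := by
        by_contra! h
        simp [hf a h] at hne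
      obtain ⟨v, hv⟩ := exists_unit_val_nsmul_eq hle hm
      exact ha ⟨v, by simp, hv⟩
    · simp only [← mul_nsmul', nsmul_eq_val_nsmul_iff, Nat.cast_mul, ZMod.natCast_zmod_val]
  have h2 (x : ZMod (addOrderOf b)) :
      ∑ u : (ZMod (addOrderOf b))ˣ, ψ u * (if x = u then 1 else 0) = ψ x := by
    by_cases hx : IsUnit x
    · obtain ⟨w, rfl⟩ := hx
      simp [Units.val_inj]
    · rw [ψ.map_nonunit hx]
      refine sum_eq_zero fun u _ ↦ ?_
      rw [if_neg, mul_zero]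
      rintro rfl
      exact hx u.isUnit
  simp_rw [h1, mul_sum]
  rw [sum_comm]
  refine sum_congr rfl fun v _ ↦ ?_
  rw [← mul_assoc, ← map_mul, ← h2, sum_mul]
  exact sum_congr rfl fun u _ ↦ by ring

/-- The twisted sums of `f` over the generators of `⟨b⟩` vanish, if `f` is supported on elements
of order at most that of `b`. -/
theorem sum_dirichletCharacter_mul_eq_zero (hG : Odd (Fintype.card G)) {f : G → ℂ}
    (hlog : ∀ χ : AddChar G ℂ, ∑ a, f a * Complex.log (1 + χ a) = 0) {b : G}
    (hf : ∀ a, addOrderOf b < addOrderOf a → f a = 0) [NeZero (addOrderOf b)]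
    {ψ : DirichletCharacter ℂ (addOrderOf b)} (hψ : ψ = 1 ∨ ψ 2 ≠ 1) :
    ∑ v : (ZMod (addOrderOf b))ˣ, ψ v * f ((v : ZMod (addOrderOf b)).val • b) = 0 := by
  classical
  set S := ∑ v : (ZMod (addOrderOf b))ˣ, ψ v * f ((v : ZMod (addOrderOf b)).val • b) with hS
  obtain ⟨κ, hκ, hlim⟩ :=
    exists_tendsto_LSeries_alternating_ne_zero (hG.of_dvd_nat (addOrderOf_dvd_card)) ψ hψ
  have horth (m : ℕ) : ∑ u : (ZMod (addOrderOf b))ˣ, ψ u * ∑ χ : AddChar G ℂ,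
      χ (-((u : ZMod (addOrderOf b)).val • b)) * ∑ a, f a * χ a ^ m =
      Fintype.card G * (ψ m * S) := by
    rw [← sum_dirichletCharacter_mul_sum_nsmul_eq hf ψ m, mul_sum]
    refine sum_congr rfl fun u _ ↦ ?_
    rw [mul_left_comm]
    congr 1
    simp_rw [mul_sum]
    rw [sum_comm]
    refine sum_congr rfl fun a _ ↦ ?_
    have h1 (χ : AddChar G ℂ) : χ (-((u : ZMod (addOrderOf b)).val • b)) * (f a * χ a ^ m) =
        f a * χ (m • a - (u : ZMod (addOrderOf b)).val • b) := by
      rw [sub_eq_neg_add, AddChar.map_add_eq_mul, AddChar.map_nsmul_eq_pow]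
      ring
    simp_rw [h1]
    rw [← mul_sum, AddChar.sum_apply_eq_ite]
    simp only [sub_eq_zero]
    split_ifs <;> ring
  have hser (s : ℝ) (hs : 1 < s) :
      ∑ u : (ZMod (addOrderOf b))ˣ, ψ u * ∑ χ : AddChar G ℂ,
        χ (-((u : ZMod (addOrderOf b)).val • b)) *
          ∑ a, f a * LSeries (fun m ↦ (-1) ^ (m + 1) * χ a ^ m) s =
      Fintype.card G * S * LSeries (fun m ↦ (-1) ^ (m + 1) * ψ m) s := by
    have h1 (χ : AddChar G ℂ) (a : G) :
        HasSum (LSeries.term (fun m ↦ (-1) ^ (m + 1) * χ a ^ m) s)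
          (LSeries (fun m ↦ (-1) ^ (m + 1) * χ a ^ m) s) :=
      (LSeriesSummable_of_bounded_of_one_lt_real (m := 1) (fun n _ ↦ by simp) hs).hasSum
    have h2 : HasSum (LSeries.term (fun m ↦ (-1) ^ (m + 1) * ψ m) s)
          (LSeries (fun m ↦ (-1) ^ (m + 1) * ψ m) s) :=
      (LSeriesSummable_of_bounded_of_one_lt_real (m := 1)
        (fun n _ ↦ by simpa using ψ.norm_le_one n) hs).hasSum
    have h3 := hasSum_sum (s := univ) fun (u : (ZMod (addOrderOf b))ˣ) _ ↦
      (hasSum_sum (s := univ) fun (χ : AddChar G ℂ) _ ↦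
      (hasSum_sum (s := univ) fun (a : G) _ ↦ (h1 χ a).mul_left (f a)).mul_left
        (χ (-((u : ZMod (addOrderOf b)).val • b)))).mul_left (ψ u)
    refine h3.unique ((h2.mul_left (Fintype.card G * S)).congr_fun fun m ↦ ?_)
    rcases eq_or_ne m 0 with rfl | hm
    · simp
    · simp only [LSeries.term_of_ne_zero hm]
      have h4 := congrArg (fun z ↦ (-1) ^ (m + 1) / (m : ℂ) ^ (s : ℂ) * z) (horth m)
      simp only [mul_sum] at h4 ⊢
      refine Eq.trans (sum_congr rfl fun u _ ↦ sum_congr rfl fun χ _ ↦ sum_congr rfl fun a _ ↦ ?_)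
        (h4.trans ?_) <;> ring
  have hzero : Tendsto (fun s : ℝ ↦ ∑ u : (ZMod (addOrderOf b))ˣ, ψ u * ∑ χ : AddChar G ℂ,
        χ (-((u : ZMod (addOrderOf b)).val • b)) *
          ∑ a, f a * LSeries (fun m ↦ (-1) ^ (m + 1) * χ a ^ m) s) (𝓝[>] 1)
      (𝓝 (∑ u : (ZMod (addOrderOf b))ˣ, ψ u * ∑ χ : AddChar G ℂ,
        χ (-((u : ZMod (addOrderOf b)).val • b)) * ∑ a, f a * Complex.log (1 + χ a))) :=
    tendsto_finsetSum _ fun u _ ↦ .const_mul _ <| tendsto_finsetSum _ fun χ _ ↦ .const_mul _ <|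
      tendsto_finsetSum _ fun a _ ↦ .const_mul _ <| tendsto_LSeries_neg_one_pow_mul_pow
        (χ.norm_apply a) (one_add_addChar_ne_zero hG χ a)
  simp only [hlog, mul_zero, sum_const_zero] at hzero
  have h5 := (hlim.const_mul (Fintype.card G * S)).congr' <| by
    filter_upwards [self_mem_nhdsWithin] with s hs using (hser s hs).symm
  have h6 := tendsto_nhds_unique hzero h5
  have hcard : (Fintype.card G : ℂ) ≠ 0 := Nat.cast_ne_zero.2 Fintype.card_ne_zero
  simpa [hκ, hcard] using h6.symm

theorem add_self_of_sum_dirichletCharacter (hG : Odd (Fintype.card G)) {f : G → ℂ} {b : G}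
    [NeZero (addOrderOf b)]
    (h : ∀ ψ : DirichletCharacter ℂ (addOrderOf b), ψ = 1 ∨ ψ 2 ≠ 1 →
      ∑ v : (ZMod (addOrderOf b))ˣ, ψ v * f ((v : ZMod (addOrderOf b)).val • b) = 0) :
    f (b + b) = f b := by
  classical
  have h2 : IsUnit (2 : ZMod (addOrderOf b)) := by
    have := (ZMod.isUnit_iff_coprime 2 (addOrderOf b)).2
      (Nat.coprime_two_left.2 (hG.of_dvd_nat addOrderOf_dvd_card))
    exact_mod_cast this
  obtain ⟨t, ht⟩ := h2
  set g : (ZMod (addOrderOf b))ˣ → ℂ := fun v ↦ f ((v : ZMod (addOrderOf b)).val • b) with hg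
  have hdiff (ψ : DirichletCharacter ℂ (addOrderOf b)) :
      ∑ v : (ZMod (addOrderOf b))ˣ, ψ v * (g (t * v) - g v) = 0 := by
    have h3 : ψ 2 * ∑ v : (ZMod (addOrderOf b))ˣ, ψ v * g (t * v) =
        ∑ v : (ZMod (addOrderOf b))ˣ, ψ v * g v := by
      rw [← Equiv.sum_comp (Equiv.mulLeft t) (fun v : (ZMod (addOrderOf b))ˣ ↦ ψ v * g v),
        mul_sum]
      refine sum_congr rfl fun v _ ↦ ?_
      rw [Equiv.coe_mulLeft, Units.val_mul, map_mul, ht, mul_assoc]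
    have hne : ψ 2 ≠ 0 := by
      rw [← ht]
      exact (t.isUnit.map ψ).ne_zero
    simp_rw [mul_sub, sum_sub_distrib]
    by_cases hψ : ψ = 1 ∨ ψ 2 ≠ 1
    · have h4 := h ψ hψ
      rw [h4] at h3
      rw [(mul_eq_zero.1 h3).resolve_left hne, h4, sub_zero]
    · push Not at hψ
      rw [hψ.2, one_mul] at h3
      rw [h3, sub_self]
  have hfour : ∑ v : (ZMod (addOrderOf b))ˣ, (g (t * v) - g v) *
      ∑ ψ : DirichletCharacter ℂ (addOrderOf b), ψ (1 : ZMod (addOrderOf b))⁻¹ * ψ v = 0 := by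
    simp_rw [mul_sum]
    rw [sum_comm]
    refine sum_eq_zero fun ψ _ ↦ ?_
    rw [← mul_zero (ψ (1 : ZMod (addOrderOf b))⁻¹), ← hdiff ψ, mul_sum]
    exact sum_congr rfl fun v _ ↦ by ring
  simp_rw [DirichletCharacter.sum_char_inv_mul_char_eq ℂ isUnit_one] at hfour
  have h5 : ∀ v : (ZMod (addOrderOf b))ˣ, ((1 : ZMod (addOrderOf b)) = v) ↔ 1 = v := fun v ↦ by
    rw [← Units.val_one, Units.val_inj]
  simp only [h5, mul_ite, mul_zero, sum_ite_eq, mem_univ, if_true, mul_one] at hfour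
  have h6 : ((addOrderOf b).totient : ℂ) ≠ 0 :=
    Nat.cast_ne_zero.2 (Nat.totient_pos.2 (addOrderOf_pos b)).ne'
  have h7 := sub_eq_zero.1 ((mul_eq_zero.1 hfour).resolve_right h6)
  have h8 := natCast_val_nsmul b 2
  have h9 := natCast_val_nsmul b 1
  rw [Nat.cast_ofNat, two_nsmul] at h8
  rw [Nat.cast_one, one_nsmul] at h9
  simpa [hg, ht, h8, h9] using h7

open Classical in
theorem sum_zmultiples_eq_eq_sum_units (f : G → ℂ) (b : G) [NeZero (addOrderOf b)] :
    ∑ a with AddSubgroup.zmultiples a = AddSubgroup.zmultiples b, f a =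
      ∑ v : (ZMod (addOrderOf b))ˣ, f ((v : ZMod (addOrderOf b)).val • b) := by
  symm
  refine sum_of_injOn (fun v : (ZMod (addOrderOf b))ˣ ↦ (v : ZMod (addOrderOf b)).val • b)
    (unit_val_nsmul_injective b).injOn (fun v _ ↦ ?_) (fun a ha hne ↦ ?_) (fun _ _ ↦ rfl)
  · have hv : addOrderOf ((v : ZMod (addOrderOf b)).val • b) = addOrderOf b :=
      Nat.Coprime.addOrderOf_nsmul (ZMod.val_coe_unit_coprime v).symm
    simp only [coe_filter, mem_univ, true_and, Set.mem_ofPred_eq]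
    refine AddSubgroup.eq_of_le_of_card_ge
      (AddSubgroup.zmultiples_le_of_mem (AddSubgroup.nsmul_mem_zmultiples b _)) ?_
    rw [Nat.card_zmultiples, Nat.card_zmultiples, hv]
  · refine (hne ?_).elim
    have ha' := (mem_filter.1 ha).2
    have hmem : b ∈ AddSubgroup.zmultiples a := ha' ▸ AddSubgroup.mem_zmultiples b
    rw [← mem_multiples_iff_mem_zmultiples] at hmem
    obtain ⟨m, hm⟩ := hmem
    have hord : addOrderOf a = addOrderOf b := by
      rw [← Nat.card_zmultiples, ha', Nat.card_zmultiples]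
    have hm' : m • a = ((1 : (ZMod (addOrderOf b))ˣ) : ZMod (addOrderOf b)).val • b := by
      have h1 := natCast_val_nsmul b 1
      rw [Nat.cast_one, one_nsmul] at h1
      rw [Units.val_one, h1]
      exact hm
    obtain ⟨v, hv⟩ := exists_unit_val_nsmul_eq hord.le hm'
    exact ⟨v, by simp, hv⟩

open Classical in
theorem sum_mem_addSubgroup_eq_zero {f : G → ℂ}
    (h : ∀ b, ∑ a with AddSubgroup.zmultiples a = AddSubgroup.zmultiples b, f a = 0)
    (H : AddSubgroup G) : ∑ a with a ∈ H, f a = 0 := by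
  rw [← sum_fiberwise_of_maps_to (t := univ.image AddSubgroup.zmultiples)
    (g := AddSubgroup.zmultiples) (fun x _ ↦ by simp)]
  refine sum_eq_zero fun y hy ↦ ?_
  obtain ⟨b, -, rfl⟩ := mem_image.1 hy
  rw [filter_filter]
  by_cases hb : b ∈ H
  · rw [← h b]
    congr 1
    ext a
    simp only [mem_filter, mem_univ, true_and, and_iff_right_iff_imp]
    intro hab
    rw [← AddSubgroup.zmultiples_le, hab]
    exact AddSubgroup.zmultiples_le_of_mem hb
  · rw [filter_eq_empty_iff.2, sum_empty]
    rintro a - ⟨ha, hab⟩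
    rw [← AddSubgroup.zmultiples_le, hab, AddSubgroup.zmultiples_le] at ha
    exact hb ha

theorem add_self_bijective (hG : Odd (Fintype.card G)) :
    Function.Bijective fun a : G ↦ a + a := by
  have h := (nsmulCoprime (G := G) (n := 2)
    (by rw [Nat.card_eq_fintype_card]; exact (Nat.coprime_two_right.2 hG))).bijective
  convert h using 2 with a
  exact (two_nsmul a).symm

open Classical in
/-- A function which is invariant under doubling and sums to zero over each set of generators of a
cyclic subgroup is orthogonal to `log ‖1 + χ‖` for each character `χ`. -/
theorem sum_mul_log_norm_one_add_eq_zero (hG : Odd (Fintype.card G)) {f : G → ℂ}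
    (hdbl : ∀ a, f (a + a) = f a)
    (h : ∀ b, ∑ a with AddSubgroup.zmultiples a = AddSubgroup.zmultiples b, f a = 0)
    (χ : AddChar G ℂ) : ∑ a, f a * (Real.log ‖1 + χ a‖ : ℂ) = 0 := by
  have h1 : ∑ a, f a * (Real.log ‖1 - χ (a + a)‖ : ℂ) = ∑ a, f a * (Real.log ‖1 - χ a‖ : ℂ) := by
    rw [← (add_self_bijective hG).sum_comp (fun a ↦ f a * (Real.log ‖1 - χ a‖ : ℂ))]
    simp only [hdbl]
  have h2 := sum_mem_addSubgroup_eq_zero h χ.toAddMonoidHom.ker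
  have h3 (a : G) : a ∈ χ.toAddMonoidHom.ker ↔ χ a = 1 := by
    rw [AddMonoidHom.mem_ker]
    rfl
  simp only [h3, sum_filter] at h2
  have h4 (a : G) : f a * (Real.log ‖1 + χ a‖ : ℂ) = f a * (Real.log ‖1 - χ (a + a)‖ : ℂ) -
      f a * (Real.log ‖1 - χ a‖ : ℂ) + (Real.log 2 : ℂ) * (if χ a = 1 then f a else 0) := by
    rw [AddChar.map_add_eq_mul]
    split_ifs with hχ
    · rw [hχ]
      norm_num
      ring
    · have h5 : 1 - χ a * χ a = (1 + χ a) * (1 - χ a) := by ring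
      rw [h5, norm_mul, Real.log_mul (norm_ne_zero_iff.2 (one_add_addChar_ne_zero hG χ a))
        (norm_ne_zero_iff.2 (sub_ne_zero.2 (Ne.symm hχ)))]
      push_cast
      ring
  simp_rw [h4, sum_add_distrib, sum_sub_distrib, ← mul_sum, h2, h1]
  ring

open Classical in
/-- An even function orthogonal to `log ‖1 + χ‖` for each character `χ` is invariant under doubling
and sums to zero over each set of generators of a cyclic subgroup. -/
theorem add_self_eq_and_sum_generators_eq_zero (hG : Odd (Fintype.card G)) {f : G → ℂ}
    (heven : ∀ a, f (-a) = f a)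
    (hlog : ∀ χ : AddChar G ℂ, ∑ a, f a * (Real.log ‖1 + χ a‖ : ℂ) = 0) (b : G) :
    f (b + b) = f b ∧
      ∑ a with AddSubgroup.zmultiples a = AddSubgroup.zmultiples b, f a = 0 := by
  induction hk : Fintype.card G - addOrderOf b using Nat.strong_induction_on generalizing b with
  | _ k ih =>
  have : NeZero (addOrderOf b) := ⟨(addOrderOf_pos b).ne'⟩
  have ih' (c : G) (hc : addOrderOf b < addOrderOf c) := by
    have := addOrderOf_le_card_univ (x := c)
    exact ih (Fintype.card G - addOrderOf c) (by omega) c rfl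
  have hord2 (a : G) : addOrderOf (a + a) = addOrderOf a := by
    rw [← two_nsmul]
    exact Nat.Coprime.addOrderOf_nsmul
      (Nat.coprime_two_right.2 (hG.of_dvd_nat addOrderOf_dvd_card))
  have hordz {a c : G} (h : AddSubgroup.zmultiples a = AddSubgroup.zmultiples c) :
      addOrderOf a = addOrderOf c := by
    rw [← Nat.card_zmultiples, h, Nat.card_zmultiples]
  set f₁ : G → ℂ := fun a ↦ if addOrderOf b < addOrderOf a then f a else 0 with hf₁
  set f₀ : G → ℂ := fun a ↦ if addOrderOf b < addOrderOf a then 0 else f a with hf₀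
  have hlog₁ := sum_mul_log_norm_one_add_eq_zero hG (f := f₁)
    (fun a ↦ by
      simp only [hf₁, hord2]
      split_ifs with h
      exacts [(ih' a h).1, rfl])
    (fun c ↦ by
      by_cases hc : addOrderOf b < addOrderOf c
      · rw [← (ih' c hc).2]
        refine sum_congr rfl fun a ha ↦ ?_
        rw [hf₁]
        simp only [hordz (mem_filter.1 ha).2, hc, if_true]
      · refine sum_eq_zero fun a ha ↦ ?_
        rw [hf₁]
        simp only [hordz (mem_filter.1 ha).2, hc, if_false])
  have hlog₀ (χ : AddChar G ℂ) : ∑ a, f₀ a * Complex.log (1 + χ a) = 0 := by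
    refine sum_mul_log_one_add_eq_zero hG (fun a ↦ ?_) ?_
    · simp only [hf₀, addOrderOf_neg, heven]
    · have hsub (a : G) : f₀ a * (Real.log ‖1 + χ a‖ : ℂ) =
          f a * (Real.log ‖1 + χ a‖ : ℂ) - f₁ a * (Real.log ‖1 + χ a‖ : ℂ) := by
        simp only [hf₀, hf₁]
        split_ifs <;> ring
      simp_rw [hsub, sum_sub_distrib, hlog χ, hlog₁ χ, sub_zero]
  have htw (ψ : DirichletCharacter ℂ (addOrderOf b)) (hψ : ψ = 1 ∨ ψ 2 ≠ 1) :=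
    sum_dirichletCharacter_mul_eq_zero hG hlog₀ (b := b) (fun a ha ↦ if_pos ha) hψ
  constructor
  · simpa [hf₀, hord2] using add_self_of_sum_dirichletCharacter hG htw
  · have h1 := htw 1 (.inl rfl)
    simp only [MulChar.one_apply_coe, one_mul] at h1
    rw [← sum_zmultiples_eq_eq_sum_units] at h1
    rw [← h1]
    refine sum_congr rfl fun a ha ↦ ?_
    simp [hf₀, hordz (mem_filter.1 ha).2]

end FiniteGroup

theorem sum_map_addChar_FS {G : Type*} [AddCommGroup G] (χ : AddChar G ℂ) (A : Multiset G) :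
    ((FS A).map χ).sum = (A.map fun a ↦ 1 + χ a).prod := by
  induction A using Multiset.induction with
  | empty => simp [FS]
  | cons a A ih =>
    rw [Multiset.map_cons, Multiset.prod_cons, ← ih]
    simp only [FS, Multiset.powerset_cons, Multiset.map_add, Multiset.map_map, Multiset.sum_add,
      Function.comp_def, Multiset.sum_cons, AddChar.map_add_eq_mul, Multiset.sum_map_mul_left]
    ring

theorem sum_count_mul_log_eq {G : Type*} [AddCommGroup G] [Fintype G] [DecidableEq G]
    (hG : Odd (Fintype.card G)) (χ : AddChar G ℂ) (A : Multiset G) :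
    ∑ a, (A.count a : ℝ) * Real.log ‖1 + χ a‖ = Real.log ‖((FS A).map χ).sum‖ := by
  rw [sum_map_addChar_FS]
  induction A using Multiset.induction with
  | empty => simp
  | cons a A ih =>
    have hne : (A.map fun a ↦ 1 + χ a).prod ≠ 0 := by
      refine Multiset.prod_ne_zero fun h0 ↦ ?_
      obtain ⟨x, -, hx⟩ := Multiset.mem_map.1 h0
      exact one_add_addChar_ne_zero hG χ x hx
    rw [Multiset.map_cons, Multiset.prod_cons, norm_mul,
      Real.log_mul (norm_ne_zero_iff.2 (one_add_addChar_ne_zero hG χ a)) (norm_ne_zero_iff.2 hne),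
      ← ih]
    simp [Multiset.count_cons, add_mul, sum_add_distrib, add_comm]

/-- If the subset sums of `A` and `B` agree up to a shift, then the difference of the multiplicity
functions of `A` and `B` lies in `V(G)`. -/
theorem memV_of_FS_eq_map_add {G : Type*} [AddCommGroup G] [Fintype G] [DecidableEq G]
    (hG : Odd (Fintype.card G)) {A B : Multiset G} {s : G}
    (h : FS A = (FS B).map (fun x ↦ x + s)) :
    memV (fun g : G ↦ (A.count g : ℤ) - (B.count g : ℤ)) := by
  classical
  set μ : G → ℤ := fun g ↦ (A.count g : ℤ) - (B.count g : ℤ) with hμ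
  have hlog (χ : AddChar G ℂ) : ∑ a, (μ a : ℝ) * Real.log ‖1 + χ a‖ = 0 := by
    have h1 : ‖((FS A).map χ).sum‖ = ‖((FS B).map χ).sum‖ := by
      rw [h, Multiset.map_map]
      simp only [Function.comp_def, AddChar.map_add_eq_mul, Multiset.sum_map_mul_right, norm_mul,
        AddChar.norm_apply, mul_one]
    have h2 := sum_count_mul_log_eq hG χ A
    rw [h1, ← sum_count_mul_log_eq hG χ B] at h2
    simp only [hμ]
    push_cast
    simp_rw [sub_mul, sum_sub_distrib, h2, sub_self]
  set f : G → ℂ := fun a ↦ μ a + μ (-a) with hf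
  have heven (a : G) : f (-a) = f a := by simp [hf, add_comm]
  have hflog (χ : AddChar G ℂ) : ∑ a, f a * (Real.log ‖1 + χ a‖ : ℂ) = 0 := by
    have h1 : ∑ a, (μ (-a) : ℝ) * Real.log ‖1 + χ a‖ = 0 := by
      rw [← hlog χ, ← Equiv.sum_comp (Equiv.neg G)]
      refine sum_congr rfl fun a _ ↦ ?_
      have hc : 1 + χ (-a) = (starRingEnd ℂ) (1 + χ a) := by
        rw [AddChar.map_neg_eq_conj, map_add, map_one]
      rw [Equiv.neg_apply, neg_neg, hc, Complex.norm_conj]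
    have h2 := congrArg₂ (· + ·) (hlog χ) h1
    simp only [← sum_add_distrib, ← add_mul, add_zero] at h2
    simp only [hf]
    exact_mod_cast congrArg (fun x : ℝ ↦ (x : ℂ)) h2
  have hmain := add_self_eq_and_sum_generators_eq_zero hG heven hflog
  refine ⟨Set.toFinite _, fun g ↦ ?_, fun H ↦ ?_⟩
  · have := (hmain g).1.symm
    simp only [hf] at this
    exact_mod_cast this
  · have h1 := sum_mem_addSubgroup_eq_zero (fun b ↦ (hmain b).2) H
    have h2 : ∑ a with a ∈ H, μ (-a) = ∑ a with a ∈ H, μ a :=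
      sum_equiv (Equiv.neg G) (by simp) (by simp)
    simp only [hf] at h1
    have h3 : ∑ a with a ∈ H, μ a + ∑ a with a ∈ H, μ (-a) = 0 := by
      rw [← sum_add_distrib]
      exact_mod_cast h1
    rw [finsum_mem_eq_sum_of_inter_support_eq (t := univ.filter (· ∈ H)) _ (by ext; simp)]
    omega

end

theorem stmt14 (n r : ℕ) (hn : Odd n) (hr : 1 ≤ r)
    (A B : Multiset (Fin r → ZMod n)) (s : Fin r → ZMod n)
    (h : FS A = (FS B).map (fun x => x + s)) :
    memV (fun g : Fin r → ZMod n => (A.count g : ℤ) - (B.count g : ℤ)) := by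
  have : NeZero n := ⟨hn.pos.ne'⟩
  convert memV_of_FS_eq_map_add ?_ h
  rw [Fintype.card_fun, ZMod.card, Fintype.card_fin]
  exact hn.pow
end

section
/- Let G be an abelian group with no elements of order 2. Let A' ⊆ A and B' ⊆ B be finite multisets of G (sub-multiset inclusion) such that FS(A) = FS(B) + s and FS(A') = FS(B') + s' for some s, s' ∈ G. Then FS(A ∖ A') = FS(B ∖ B') + (s − s'), where ∖ denotes multiset difference. -/
open scoped BigOperators

theorem FS_cons {G : Type*} [AddCommMonoid G] (a : G) (A : Multiset G) :
    FS (a ::ₘ A) = FS A + (FS A).map (a + ·) := by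
  simp [FS, Multiset.powerset_cons]

theorem FS_add {G : Type*} [AddCommMonoid G] (A B : Multiset G) :
    FS (A + B) = (FS A).bind fun x => (FS B).map (x + ·) := by
  induction A using Multiset.induction_on with
  | empty => simp [FS]
  | cons a A ih =>
    rw [Multiset.cons_add, FS_cons, FS_cons, ih, Multiset.add_bind, Multiset.bind_map,
      Multiset.map_bind]
    simp [add_assoc]

theorem add_map_add_left_injective {G : Type*} [AddCommGroup G]
    (h2 : ∀ g : G, g + g = 0 → g = 0) (a : G) :
    Function.Injective fun X : Multiset G => X + X.map (a + ·) := by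
  classical
  intro X Y h
  have count_shift (Z : Multiset G) (g : G) :
      (Z.map (a + ·)).count (a + g) = Z.count g :=
    Multiset.count_map_eq_count' _ _ (add_right_injective a) _
  set d : G → ℤ := fun g => (X.count g : ℤ) - Y.count g with hd
  have hstep (g : G) : d (a + g) = -d g := by
    have := congrArg (Multiset.count (a + g)) h
    simp only [Multiset.count_add, count_shift] at this
    simp only [hd]
    omega
  have hiter (n : ℕ) (g : G) : d (n • a + g) = (-1) ^ n * d g := by
    induction n with
    | zero => simp
    | succ n ih =>
      rw [succ_nsmul', add_assoc, hstep, ih, pow_succ]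
      ring
  have hzero (g : G) : d g = 0 := by
    by_contra hg
    have hmem (n : ℕ) : n • a + g ∈ (X + Y).toFinset := by
      by_contra hn
      simp only [Multiset.mem_toFinset, Multiset.mem_add, not_or] at hn
      have := hiter n g
      simp only [hd, Multiset.count_eq_zero_of_notMem hn.1,
        Multiset.count_eq_zero_of_notMem hn.2] at this
      simp at this
      exact hg this
    have hfin : IsOfFinAddOrder a := by
      by_contra hinf
      have hinj : Function.Injective fun n : ℕ => n • a + g :=
        (add_left_injective g).comp (injective_nsmul_iff_not_isOfFinAddOrder.2 hinf)
      exact Set.infinite_of_injective_forall_mem hinj hmem (Finset.finite_toSet _)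
    rcases Nat.even_or_odd (addOrderOf a) with ⟨m, hm⟩ | hodd
    · have hpos := hfin.addOrderOf_pos
      have hma : m • a = 0 := h2 _ (by rw [← add_nsmul, ← hm, addOrderOf_nsmul_eq_zero])
      have := addOrderOf_le_of_nsmul_eq_zero (by omega) hma
      omega
    · have := hiter (addOrderOf a) g
      rw [addOrderOf_nsmul_eq_zero, hodd.neg_one_pow, zero_add] at this
      omega
  ext g
  have := hzero g
  simp only [hd] at this
  omega

theorem FS_bind_map_add_injective {G : Type*} [AddCommGroup G]
    (h2 : ∀ g : G, g + g = 0 → g = 0) (A : Multiset G) :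
    Function.Injective fun X : Multiset G => (FS A).bind fun x => X.map (x + ·) := by
  induction A using Multiset.induction_on with
  | empty =>
    intro X Y h
    simpa [FS] using h
  | cons a A ih =>
    intro X Y h
    apply ih
    apply add_map_add_left_injective h2 a
    simpa [FS_cons, Multiset.add_bind, Multiset.bind_map, Multiset.map_bind, add_assoc] using h

theorem stmt16 {G : Type*} [AddCommGroup G] [DecidableEq G]
    (h2 : ∀ g : G, g + g = 0 → g = 0)
    (A A' B B' : Multiset G) (hA : A' ≤ A) (hB : B' ≤ B) (s s' : G)
    (h : FS A = (FS B).map (fun x => x + s))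
    (h' : FS A' = (FS B').map (fun x => x + s')) :
    FS (A - A') = (FS (B - B')).map (fun x => x + (s - s')) := by
  apply FS_bind_map_add_injective h2 A'
  dsimp only
  rw [← FS_add, add_tsub_cancel_of_le hA, h, ← add_tsub_cancel_of_le hB, FS_add,
    add_tsub_cancel_of_le hB, h', Multiset.bind_map, Multiset.map_bind]
  simp only [Multiset.map_map, Function.comp_def]
  refine Multiset.bind_congr fun x _ => Multiset.map_congr rfl fun y _ => ?_
  abel
end

section
/- Let n, r ≥ 1 be natural numbers, and let f : (ℤ/nℤ)^r → ℂ be a function. Then for every x ∈ (ℤ/nℤ)^r, f(x) = (1/(n^{r−1} φ(n))) · Σ_{ψ ∈ Hom((ℤ/nℤ)^r, ℤ/nℤ)} Rf(ψ, ψ(x)) · ∏_{p | ψ} (1 − p^{r−1}), where the product runs over all prime divisors p of n such that ψ takes values in pℤ/nℤ, and φ is Euler's totient function. -/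
open scoped BigOperators

theorem AddSubgroup.card_comap_eq_card_ker_mul {G G' : Type*} [AddGroup G] [AddGroup G']
    (φ : G →+ G') (H : AddSubgroup G') :
    Nat.card (H.comap φ) = Nat.card φ.ker * Nat.card (φ.range ⊓ H : AddSubgroup G') := by
  have hle : φ.ker ≤ H.comap φ := fun a ha => by
    rw [AddSubgroup.mem_comap, AddMonoidHom.mem_ker.mp ha]
    exact H.zero_mem
  have h := AddSubgroup.relIndex_mul_relIndex ⊥ φ.ker (H.comap φ) bot_le hle
  rw [AddSubgroup.relIndex_bot_left, AddSubgroup.relIndex_bot_left, AddSubgroup.relIndex_ker,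
    AddSubgroup.map_comap_eq] at h
  exact h.symm

/-- Homomorphisms out of `(ℤ/nℤ)^r` into `ℤ/nℤ` correspond to their values on the standard
basis. -/
noncomputable def homEquivFun (n r : ℕ) :
    ((Fin r → ZMod n) →+ ZMod n) ≃+ (Fin r → ZMod n) :=
  (AddMonoidHom.toZModLinearMapEquiv n).trans
    ((Pi.basisFun (ZMod n) (Fin r)).constr ℤ).symm.toAddEquiv

theorem homEquivFun_apply {n r : ℕ} (ψ : (Fin r → ZMod n) →+ ZMod n) (i : Fin r) :
    homEquivFun n r ψ i = ψ (Pi.single i 1) := by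
  simp [homEquivFun, Module.Basis.constr]
  rfl

theorem card_hom_pi_zmod (n r : ℕ) :
    Nat.card ((Fin r → ZMod n) →+ ZMod n) = n ^ r := by
  rw [Nat.card_congr (homEquivFun n r).toEquiv, Nat.card_fun, Nat.card_zmod, Nat.card_fin]

theorem card_ker_nsmul_hom_pi_zmod {n r d : ℕ} [NeZero n] (hd : d ∣ n) :
    Nat.card (nsmulAddMonoidHom d :
      ((Fin r → ZMod n) →+ ZMod n) →+ ((Fin r → ZMod n) →+ ZMod n)).ker = d ^ r := by
  have e : (nsmulAddMonoidHom d :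
      ((Fin r → ZMod n) →+ ZMod n) →+ ((Fin r → ZMod n) →+ ZMod n)).ker ≃
      (Fin r → (nsmulAddMonoidHom d : ZMod n →+ ZMod n).ker) :=
    ((homEquivFun n r).toEquiv.subtypeEquiv (fun ψ => by
      change d • ψ = 0 ↔ ∀ i, d • (homEquivFun n r ψ i) = 0
      rw [← (homEquivFun n r).map_eq_zero_iff, map_nsmul, funext_iff]
      rfl)).trans (Equiv.subtypePiEquivPi (p := fun (_ : Fin r) c => d • c = (0 : ZMod n)))
  rw [Nat.card_congr e, Nat.card_fun, IsAddCyclic.card_nsmulAddMonoidHom_ker]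
  simp [Nat.gcd_eq_right hd]

theorem card_range_eval_hom_pi_zmod {n r : ℕ} [NeZero n] (y : Fin r → ZMod n) :
    Nat.card (AddMonoidHom.eval y : ((Fin r → ZMod n) →+ ZMod n) →+ ZMod n).range =
      addOrderOf y := by
  rw [← IsAddCyclic.exponent_eq_card]
  apply Nat.dvd_antisymm
  · rw [AddMonoid.exponent_dvd_iff_forall_nsmul_eq_zero]
    rintro ⟨_, ψ, rfl⟩
    ext1
    change addOrderOf y • ψ y = 0
    rw [← map_nsmul, addOrderOf_nsmul_eq_zero, map_zero]
  · rw [addOrderOf_dvd_iff_nsmul_eq_zero]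
    funext i
    have h := AddMonoid.exponent_nsmul_eq_zero
      (⟨y i, Pi.evalAddMonoidHom (fun _ => ZMod n) i, rfl⟩ :
        (AddMonoidHom.eval y : ((Fin r → ZMod n) →+ ZMod n) →+ ZMod n).range)
    exact congrArg Subtype.val h

theorem card_range_nsmul_inf_ker_eval {n r d : ℕ} [NeZero n] (hd : d ∣ n) (z : Fin r → ZMod n) :
    d ^ r * Nat.card ((nsmulAddMonoidHom d :
      ((Fin r → ZMod n) →+ ZMod n) →+ ((Fin r → ZMod n) →+ ZMod n)).range ⊓
        (AddMonoidHom.eval z : ((Fin r → ZMod n) →+ ZMod n) →+ ZMod n).ker : AddSubgroup _) *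
      (addOrderOf z / (addOrderOf z).gcd d) = n ^ r := by
  rw [← card_ker_nsmul_hom_pi_zmod hd, ← AddSubgroup.card_comap_eq_card_ker_mul,
    ← addOrderOf_nsmul, ← card_range_eval_hom_pi_zmod, ← card_hom_pi_zmod n r,
    ← AddSubgroup.card_mul_index
      (AddMonoidHom.eval (d • z) : ((Fin r → ZMod n) →+ ZMod n) →+ ZMod n).ker, AddSubgroup.index_ker]
  congr 2
  apply congrArg (fun H : AddSubgroup ((Fin r → ZMod n) →+ ZMod n) => (H : Type))
  ext ψ
  change d • ψ z = 0 ↔ ψ (d • z) = 0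
  rw [map_nsmul]

theorem mem_range_nsmul_prod_iff {n r : ℕ} {T : Finset ℕ} (hT : ∀ p ∈ T, p.Prime)
    (ψ : (Fin r → ZMod n) →+ ZMod n) :
    ψ ∈ (nsmulAddMonoidHom (∏ p ∈ T, p) :
      ((Fin r → ZMod n) →+ ZMod n) →+ ((Fin r → ZMod n) →+ ZMod n)).range ↔
      ∀ p ∈ T, ∀ z, ∃ w, ψ z = (p : ZMod n) * w := by
  constructor
  · rintro ⟨a, rfl⟩ p hp z
    obtain ⟨k, hk⟩ := Finset.dvd_prod_of_mem (fun p : ℕ => p) hp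
    refine ⟨(k : ZMod n) * a z, ?_⟩
    simp [hk, mul_assoc]
  · intro h
    have hdvd : ∀ i, ∃ w, homEquivFun n r ψ i = (∏ p ∈ T, (p : ZMod n)) * w := by
      intro i
      rw [homEquivFun_apply]
      refine Finset.prod_dvd_of_coprime (fun p hp q hq hpq => ?_) (fun p hp => h p hp _)
      have hc := (Nat.isCoprime_iff_coprime.mpr
        ((Nat.coprime_primes (hT p hp) (hT q hq)).mpr hpq)).map (Int.castRingHom (ZMod n))
      simpa using hc
    choose w hw using hdvd
    refine ⟨(homEquivFun n r).symm w, (homEquivFun n r).injective ?_⟩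
    funext i
    simp [hw]

theorem gcd_prod_primes (m : ℕ) {T : Finset ℕ} (hT : ∀ p ∈ T, p.Prime) :
    m.gcd (∏ p ∈ T, p) = ∏ p ∈ T, m.gcd p := by
  induction T using Finset.induction_on with
  | empty => simp
  | insert q T hq ih =>
    rw [Finset.prod_insert hq, Finset.prod_insert hq, Nat.Coprime.gcd_mul,
      ih fun p hp => hT p (Finset.mem_insert_of_mem hp)]
    refine Nat.Coprime.prod_right fun p hp => ?_
    refine (Nat.coprime_primes (hT q (Finset.mem_insert_self _ _))
      (hT p (Finset.mem_insert_of_mem hp))).mpr ?_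
    rintro rfl
    exact hq hp

open Classical in
theorem sum_hom_weight {n r : ℕ} [NeZero n] [Fintype ((Fin r → ZMod n) →+ ZMod n)] (hr : 1 ≤ r)
    (z : Fin r → ZMod n) :
    ∑ ψ : (Fin r → ZMod n) →+ ZMod n, (if ψ z = 0 then
      ∏ p ∈ n.primeFactors, (1 + if ∀ y, ∃ w, ψ y = (p : ZMod n) * w
        then -(p : ℂ) ^ (r - 1) else 0) else 0) =
      (n : ℂ) ^ r / addOrderOf z *
        ∏ p ∈ n.primeFactors, (1 - ((addOrderOf z).gcd p : ℂ) / p) := by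
  have hm : (addOrderOf z : ℂ) ≠ 0 := by exact_mod_cast (addOrderOf_pos z).ne'
  simp_rw [sub_eq_add_neg, Finset.prod_one_add, Finset.mul_sum, ← Finset.sum_filter]
  rw [Finset.sum_comm]
  refine Finset.sum_congr rfl fun T hT => ?_
  have hTn := Finset.mem_powerset.mp hT
  have hTp : ∀ p ∈ T, p.Prime := fun p hp => Nat.prime_of_mem_primeFactors (hTn hp)
  have hdn : (∏ p ∈ T, p) ∣ n :=
    (Finset.prod_dvd_prod_of_subset _ _ _ hTn).trans (Nat.prod_primeFactors_dvd n)
  have hcount := card_range_nsmul_inf_ker_eval hdn z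
  simp_rw [Finset.prod_ite_zero]
  rw [← Finset.sum_filter, Finset.sum_const, Finset.filter_filter, nsmul_eq_mul]
  have hcard : Nat.card ((nsmulAddMonoidHom (∏ p ∈ T, p) :
      ((Fin r → ZMod n) →+ ZMod n) →+ ((Fin r → ZMod n) →+ ZMod n)).range ⊓
        (AddMonoidHom.eval z : ((Fin r → ZMod n) →+ ZMod n) →+ ZMod n).ker : AddSubgroup _) =
      (Finset.univ.filter fun ψ : (Fin r → ZMod n) →+ ZMod n =>
        ψ z = 0 ∧ ∀ p ∈ T, ∀ y, ∃ w, ψ y = (p : ZMod n) * w).card := by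
    rw [← Fintype.card_subtype, ← Nat.card_eq_fintype_card]
    refine Nat.card_congr (Equiv.subtypeEquivRight fun ψ => ?_)
    rw [AddSubgroup.mem_inf, mem_range_nsmul_prod_iff hTp, and_comm]
    rfl
  rw [hcard] at hcount
  have hc := congrArg (Nat.cast : ℕ → ℂ) hcount
  have hg : ((addOrderOf z).gcd (∏ p ∈ T, p) : ℂ) ≠ 0 := by
    exact_mod_cast (Nat.gcd_pos_of_pos_left _ (addOrderOf_pos z)).ne'
  have hprod : (∏ p ∈ T, (p : ℂ)) ≠ 0 :=
    Finset.prod_ne_zero_iff.mpr fun p hp => by exact_mod_cast (hTp p hp).ne_zero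
  have hsplit : ∏ p ∈ T, -((addOrderOf z).gcd p / p : ℂ) =
      (∏ p ∈ T, (-1 : ℂ)) * (((addOrderOf z).gcd (∏ p ∈ T, p) : ℕ) / ∏ p ∈ T, (p : ℂ)) := by
    rw [gcd_prod_primes _ hTp, Nat.cast_prod, ← Finset.prod_div_distrib,
      ← Finset.prod_mul_distrib]
    simp
  have hsplit' : ∏ p ∈ T, -(p : ℂ) ^ (r - 1) =
      (∏ p ∈ T, (-1 : ℂ)) * (∏ p ∈ T, (p : ℂ)) ^ (r - 1) := by
    rw [← Finset.prod_pow, ← Finset.prod_mul_distrib]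
    simp
  rw [hsplit, hsplit']
  obtain ⟨s, rfl⟩ : ∃ s, r = s + 1 := ⟨r - 1, by omega⟩
  rw [Nat.cast_mul, Nat.cast_mul, Nat.cast_div (Nat.gcd_dvd_left _ _) hg] at hc
  push_cast at hc
  rw [← hc]
  simp only [Nat.add_sub_cancel]
  field_simp
  ring

theorem prod_one_sub_gcd_addOrderOf {n r : ℕ} [NeZero n] (hr : 1 ≤ r) (z : Fin r → ZMod n) :
    (n : ℂ) ^ r / addOrderOf z *
        ∏ p ∈ n.primeFactors, (1 - ((addOrderOf z).gcd p : ℂ) / p) =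
      if z = 0 then (n : ℂ) ^ (r - 1) * n.totient else 0 := by
  split_ifs with hz
  · have h := congrArg (Rat.cast : ℚ → ℂ) (Nat.totient_eq_mul_prod_factors n)
    push_cast at h
    obtain ⟨s, rfl⟩ : ∃ s, r = s + 1 := ⟨r - 1, by omega⟩
    simp [hz, h, pow_succ, mul_assoc]
  · have hne : addOrderOf z ≠ 1 := fun h => hz (AddMonoid.addOrderOf_eq_one_iff.mp h)
    obtain ⟨p, hp, hpz⟩ := Nat.exists_prime_and_dvd hne
    have hzn : addOrderOf z ∣ n := by
      rw [addOrderOf_dvd_iff_nsmul_eq_zero]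
      funext i
      simp
    rw [Finset.prod_eq_zero (Nat.mem_primeFactors.mpr ⟨hp, hpz.trans hzn, NeZero.ne n⟩), mul_zero]
    rw [Nat.gcd_eq_right hpz, div_self (by exact_mod_cast hp.ne_zero), sub_self]

open Classical in
theorem finprod_primes_dvd_hom {n r : ℕ} [NeZero n] (ψ : (Fin r → ZMod n) →+ ZMod n) :
    ∏ᶠ p ∈ {p : ℕ | p.Prime ∧ p ∣ n ∧
        ∀ z : Fin r → ZMod n, ∃ w : ZMod n, ψ z = (p : ZMod n) * w}, (1 - (p : ℂ) ^ (r - 1)) =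
      ∏ p ∈ n.primeFactors, (1 + if ∀ y, ∃ w, ψ y = (p : ZMod n) * w
        then -(p : ℂ) ^ (r - 1) else 0) := by
  have hset : {p : ℕ | p.Prime ∧ p ∣ n ∧
      ∀ z : Fin r → ZMod n, ∃ w : ZMod n, ψ z = (p : ZMod n) * w} =
      ((n.primeFactors.filter fun p => ∀ y, ∃ w, ψ y = (p : ZMod n) * w : Finset ℕ) : Set ℕ) := by
    ext p
    simp [NeZero.ne n, and_assoc]
  rw [hset, finprod_mem_coe_finset, Finset.prod_filter]
  refine Finset.prod_congr rfl fun p _ => ?_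
  split_ifs <;> ring

theorem stmt19 (n r : ℕ) [NeZero n] (hr : 1 ≤ r)
    (f : (Fin r → ZMod n) → ℂ) (x : Fin r → ZMod n) :
    f x = (1 / ((n : ℂ) ^ (r - 1) * (Nat.totient n : ℂ))) *
      ∑ᶠ ψ : (Fin r → ZMod n) →+ ZMod n,
        (∑ y ∈ Finset.univ.filter (fun y : Fin r → ZMod n => ψ y = ψ x), f y) *
          ∏ᶠ p ∈ {p : ℕ | p.Prime ∧ p ∣ n ∧
              ∀ z : Fin r → ZMod n, ∃ w : ZMod n, ψ z = (p : ZMod n) * w},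
            (1 - (p : ℂ) ^ (r - 1)) := by
  classical
  have : Fintype ((Fin r → ZMod n) →+ ZMod n) := Fintype.ofEquiv _ (homEquivFun n r).symm.toEquiv
  have hn : (n : ℂ) ^ (r - 1) * (Nat.totient n : ℂ) ≠ 0 :=
    mul_ne_zero (pow_ne_zero _ (NeZero.ne _))
      (by exact_mod_cast (Nat.totient_pos.mpr (NeZero.pos n)).ne')
  rw [finsum_eq_sum_of_fintype]
  simp_rw [finprod_primes_dvd_hom, Finset.sum_filter, Finset.sum_mul]
  rw [Finset.sum_comm]
  have key : ∀ y, ∑ ψ : (Fin r → ZMod n) →+ ZMod n, (if ψ y = ψ x then f y else 0) *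
      ∏ p ∈ n.primeFactors, (1 + if ∀ y, ∃ w, ψ y = (p : ZMod n) * w
        then -(p : ℂ) ^ (r - 1) else 0) =
      if y = x then f y * ((n : ℂ) ^ (r - 1) * n.totient) else 0 := by
    intro y
    have h := (sum_hom_weight hr (y - x)).trans (prod_one_sub_gcd_addOrderOf hr (y - x))
    simp_rw [sub_eq_zero, map_sub, sub_eq_zero] at h
    rw [← mul_ite_zero, ← h, Finset.mul_sum]
    refine Finset.sum_congr rfl fun ψ _ => ?_
    split_ifs <;> simp
  simp_rw [key]
  rw [Finset.sum_ite_eq' Finset.univ x]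
  simp only [Finset.mem_univ, if_true]
  rw [mul_comm (f x), one_div, inv_mul_cancel_left₀ hn]
end
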